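/- Let N ≥ 2 and let Ω ⊊ ℝ^N be a nonempty bounded convex open set. Then the ratio 𝔥_{s,1}(Ω)/𝔥_{s,1}(ℍ^N_+) tends to 1/2 as s → 1⁻. -/

import Mathlib

open MeasureTheory Metric Set Filter
open scoped ENNReal NNReal

/-- The `p`-th power of the Gagliardo `(s,p)`-seminorm of `u` on `A ⊆ ℝ^N`,
valued in `[0,∞]`. -/
noncomputable def gagliardo (N : ℕ) (s p : ℝ) (A : Set (EuclideanSpace ℝ (Fin N)))
    (u : EuclideanSpace ℝ (Fin N) → ℝ) : ℝ≥0∞ :=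
  ∫⁻ x in A, ∫⁻ y in A, ENNReal.ofReal (|u x - u y| ^ p / dist x y ^ ((N : ℝ) + s * p))

/-- The sharp fractional Hardy constant `𝔥_{s,p}(Ω)`, an element of `[0,∞]`. -/
noncomputable def hardyConst (N : ℕ) (s p : ℝ) (Ω : Set (EuclideanSpace ℝ (Fin N))) : ℝ≥0∞ :=
  sInf { c : ℝ≥0∞ | ∃ u : EuclideanSpace ℝ (Fin N) → ℝ,
    ContDiff ℝ (⊤ : ℕ∞) u ∧ HasCompactSupport u ∧ tsupport u ⊆ Ω ∧
    (∫ x in Ω, |u x| ^ p / Metric.infDist x (frontier Ω) ^ (s * p)) = 1 ∧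
    c = gagliardo N s p Set.univ u }

/-- The half-space `ℍ^N₊ = (0,∞) × ℝ^{N-1}`. -/
noncomputable def halfSpace (N : ℕ) (hN : 0 < N) : Set (EuclideanSpace ℝ (Fin N)) :=
  {x | 0 < x ⟨0, hN⟩}

/-- kernel -/
noncomputable def kk (N : ℕ) (s : ℝ) (h : EuclideanSpace ℝ (Fin N)) : ℝ≥0∞ :=
  ENNReal.ofReal (1 / ‖h‖ ^ ((N : ℝ) + s))

/-- half-space potential -/
noncomputable def JJ (N : ℕ) (hN : 0 < N) (s : ℝ) : ℝ≥0∞ :=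
  ∫⁻ h in {h : EuclideanSpace ℝ (Fin N) | 1 < h ⟨0, hN⟩}, kk N s h

lemma kk_meas (N : ℕ) (s : ℝ) : Measurable (kk N s) := by
  unfold kk; fun_prop

lemma kk_neg (N : ℕ) (s : ℝ) (h : EuclideanSpace ℝ (Fin N)) : kk N s (-h) = kk N s h := by
  simp [kk]

lemma gag_eq (N : ℕ) (s : ℝ) (u : EuclideanSpace ℝ (Fin N) → ℝ) :
    gagliardo N s 1 Set.univ u = ∫⁻ x, ∫⁻ y, ENNReal.ofReal |u x - u y| * kk N s (x - y) := by
  unfold gagliardo kk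
  simp only [Measure.restrict_univ, Real.rpow_one, mul_one]
  congr 1; ext x; congr 1; ext y
  rw [← ENNReal.ofReal_mul (abs_nonneg _), dist_eq_norm]
  congr 1
  ring

lemma kk_smul (N : ℕ) (s t : ℝ) (ht : 0 < t) (h : EuclideanSpace ℝ (Fin N)) :
    kk N s (t • h) = ENNReal.ofReal (t ^ (-((N : ℝ) + s))) * kk N s h := by
  unfold kk
  rw [← ENNReal.ofReal_mul (by positivity), norm_smul, Real.norm_of_nonneg ht.le,
    Real.mul_rpow ht.le (norm_nonneg _), Real.rpow_neg ht.le]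
  congr 1
  rw [one_div, mul_inv, one_div]

lemma kk_half0 (N : ℕ) (hN : 0 < N) (s t : ℝ) (ht : 0 < t) :
    ∫⁻ h in {h : EuclideanSpace ℝ (Fin N) | t < h ⟨0, hN⟩}, kk N s h
      = ENNReal.ofReal (t ^ (-s)) * JJ N hN s := by
  have hS : MeasurableSet {h : EuclideanSpace ℝ (Fin N) | t < h ⟨0, hN⟩} :=
    measurableSet_lt measurable_const (by fun_prop)
  have hmap := Measure.map_addHaar_smul (volume : Measure (EuclideanSpace ℝ (Fin N))) ht.ne'
  have h1 := setLIntegral_map (μ := (volume : Measure (EuclideanSpace ℝ (Fin N))))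
    (g := fun x => t • x) hS (kk_meas N s) (by fun_prop)
  rw [hmap] at h1
  have hpre : (fun x : EuclideanSpace ℝ (Fin N) => t • x) ⁻¹' {h | t < h ⟨0, hN⟩}
      = {h | 1 < h ⟨0, hN⟩} := by
    ext x; simp [ht]
  rw [hpre, Measure.restrict_smul, lintegral_smul_measure] at h1
  simp only [kk_smul N s t ht, finrank_euclideanSpace, Fintype.card_fin, smul_eq_mul] at h1
  rw [lintegral_const_mul _ (kk_meas N s), abs_of_pos (by positivity)] at h1
  have h2 : ENNReal.ofReal (t ^ N) * ENNReal.ofReal ((t ^ N)⁻¹) = 1 := by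
    rw [← ENNReal.ofReal_mul (by positivity), mul_inv_cancel₀ (by positivity), ENNReal.ofReal_one]
  calc _ = ENNReal.ofReal (t ^ N) * (ENNReal.ofReal ((t ^ N)⁻¹) *
      ∫⁻ h in {h : EuclideanSpace ℝ (Fin N) | t < h ⟨0, hN⟩}, kk N s h) := by
        rw [← mul_assoc, h2, one_mul]
    _ = _ := by
        rw [h1, ← mul_assoc, ← ENNReal.ofReal_mul (by positivity), JJ]
        congr 2
        rw [← Real.rpow_natCast, ← Real.rpow_add ht]
        congr 1; ring

lemma kk_half (N : ℕ) (hN : 0 < N) (s t : ℝ) (ht : 0 < t) (ν : EuclideanSpace ℝ (Fin N))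
    (hν : ‖ν‖ = 1) :
    ∫⁻ h in {h : EuclideanSpace ℝ (Fin N) | t < inner ℝ ν h}, kk N s h
      = ENNReal.ofReal (t ^ (-s)) * JJ N hN s := by
  rw [← kk_half0 N hN s t ht]
  set e : EuclideanSpace ℝ (Fin N) := EuclideanSpace.single ⟨0, hN⟩ 1 with he
  have hne : ‖ν‖ = ‖e‖ := by rw [hν, he]; simp
  have hL := Submodule.reflection_sub hne
  set L := (Submodule.span ℝ {ν - e})ᗮ.reflection with hLdef
  rw [← (LinearIsometryEquiv.measurePreserving L).setLIntegral_comp_preimage_emb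
    L.toHomeomorph.measurableEmbedding (kk N s) {h | t < h ⟨0, hN⟩}]
  have : (L ⁻¹' {h | t < h ⟨0, hN⟩}) = {h | t < inner ℝ ν h} := by
    ext h
    simp only [mem_preimage, mem_ofPred_eq]
    rw [← L.inner_map_map ν h, hL, he, EuclideanSpace.inner_single_left]
    simp
  rw [this]
  simp [kk]

lemma JJ_pos (N : ℕ) (hN : 0 < N) (s : ℝ) : JJ N hN s ≠ 0 := by
  unfold JJ
  have ho : IsOpen {h : EuclideanSpace ℝ (Fin N) | 1 < h ⟨0, hN⟩} :=
    isOpen_lt continuous_const (by fun_prop)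
  rw [← pos_iff_ne_zero, setLIntegral_pos_iff (kk_meas N s)]
  have : (Function.support (kk N s) ∩ {h : EuclideanSpace ℝ (Fin N) | 1 < h ⟨0, hN⟩})
    = {h : EuclideanSpace ℝ (Fin N) | 1 < h ⟨0, hN⟩} := by
    refine inter_eq_right.2 fun h hh => ?_
    have h0 : h ≠ 0 := by
      rintro rfl
      simp only [mem_ofPred_eq, PiLp.zero_apply] at hh
      linarith
    have : 0 < ‖h‖ := norm_pos_iff.2 h0
    simp only [Function.mem_support, kk, ne_eq, ENNReal.ofReal_eq_zero, not_le]
    positivity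
  rw [this]
  refine ho.measure_pos _ ⟨EuclideanSpace.single ⟨0, hN⟩ 2, ?_⟩
  simp

lemma JJ_fin (N : ℕ) (hN : 0 < N) (s : ℝ) (hs : 0 < s) : JJ N hN s ≠ ⊤ := by
  unfold JJ
  have h1 : (Module.finrank ℝ (EuclideanSpace ℝ (Fin N)) : ℝ) < N + s := by simp [hs]
  have h2 := finite_integral_one_add_norm
    (μ := (volume : Measure (EuclideanSpace ℝ (Fin N)))) h1
  refine ne_of_lt (lt_of_le_of_lt ?_
    (ENNReal.mul_lt_top (ENNReal.ofReal_lt_top (r := 2 ^ ((N : ℝ) + s))) h2))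
  rw [← lintegral_const_mul' _ _ ENNReal.ofReal_ne_top]
  refine le_trans (setLIntegral_mono' (g := fun x => ENNReal.ofReal (2 ^ ((N : ℝ) + s)) *
    ENNReal.ofReal ((1 + ‖x‖) ^ (-((N : ℝ) + s))))
    (measurableSet_lt measurable_const (by fun_prop)) fun h hh => ?_)
    (setLIntegral_le_lintegral _ _)
  simp only [mem_ofPred_eq] at hh
  have h3 : 1 ≤ ‖h‖ := by
    have := PiLp.norm_apply_le h ⟨0, hN⟩
    rw [Real.norm_eq_abs] at this
    linarith [le_abs_self (h ⟨0, hN⟩)]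
  rw [← ENNReal.ofReal_mul (by positivity)]
  refine ENNReal.ofReal_le_ofReal ?_
  rw [Real.rpow_neg (by positivity), ← div_eq_mul_inv, ← Real.div_rpow (by positivity) (by positivity),
    one_div, ← Real.inv_rpow (by positivity)]
  refine Real.rpow_le_rpow (by positivity) ?_ (by positivity)
  rw [inv_eq_one_div, div_le_div_iff₀ (by positivity) (by positivity)]
  linarith

/-- tail bound -/
lemma kk_tail (N : ℕ) (hN : 0 < N) (s : ℝ) (hs : 0 < s) (hs1 : s < 1) :
    ∫⁻ h in {h : EuclideanSpace ℝ (Fin N) | 1 ≤ ‖h‖}, kk N s h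
      ≤ ENNReal.ofReal (4 * N ^ 2) * JJ N hN s := by
  have hN' : (0 : ℝ) < N := by exact_mod_cast hN
  set r : ℝ := 1 / (2 * N) with hr
  have hrpos : 0 < r := by positivity
  have hsub : {h : EuclideanSpace ℝ (Fin N) | 1 ≤ ‖h‖} ⊆
      ⋃ i : Fin N, ({h | r < inner ℝ (EuclideanSpace.single i (1:ℝ)) h} ∪
        {h | r < inner ℝ (-EuclideanSpace.single i (1:ℝ)) h}) := by
    intro h hh
    by_contra hcon
    simp only [mem_iUnion, mem_union, mem_ofPred_eq, not_exists, not_or, not_lt, inner_neg_left,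
      EuclideanSpace.inner_single_left, map_one, one_mul] at hcon hh
    have h1 : ‖h‖ ≤ ∑ i, |h i| := by
      rw [EuclideanSpace.norm_eq]
      refine Real.sqrt_le_iff.2 ⟨Finset.sum_nonneg fun _ _ => abs_nonneg _, ?_⟩
      simp only [Real.norm_eq_abs]
      exact Finset.sum_sq_le_sq_sum_of_nonneg fun _ _ => abs_nonneg _
    have h2 : ∑ i, |h i| ≤ ∑ i : Fin N, r :=
      Finset.sum_le_sum fun i _ => abs_le.2 ⟨by linarith [(hcon i).2], (hcon i).1⟩
    rw [Finset.sum_const, Finset.card_univ, Fintype.card_fin, nsmul_eq_mul] at h2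
    have h3 : (N : ℝ) * r = 1 / 2 := by rw [hr]; field_simp
    linarith
  have hr2 : r ^ (-s) ≤ 2 * N := by
    have h1 : (1 : ℝ) ≤ N := by exact_mod_cast hN
    rw [hr, one_div, Real.inv_rpow (by positivity), Real.rpow_neg (by positivity), inv_inv]
    calc (2 * (N : ℝ)) ^ s ≤ (2 * (N : ℝ)) ^ (1 : ℝ) :=
          Real.rpow_le_rpow_of_exponent_le (by linarith) hs1.le
      _ = _ := Real.rpow_one _
  calc _ ≤ ∫⁻ h in ⋃ i : Fin N, ({h | r < inner ℝ (EuclideanSpace.single i (1:ℝ)) h} ∪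
        {h | r < inner ℝ (-EuclideanSpace.single i (1:ℝ)) h}), kk N s h :=
        lintegral_mono_set hsub
    _ ≤ ∑' i : Fin N, ∫⁻ h in ({h | r < inner ℝ (EuclideanSpace.single i (1:ℝ)) h} ∪
        {h | r < inner ℝ (-EuclideanSpace.single i (1:ℝ)) h}), kk N s h :=
        lintegral_iUnion_le _ _
    _ ≤ ∑' i : Fin N, (2 * (ENNReal.ofReal (r ^ (-s)) * JJ N hN s)) := by
        refine ENNReal.tsum_le_tsum fun i => (lintegral_union_le _ _ _).trans ?_
        rw [kk_half N hN s r hrpos _ (by simp), kk_half N hN s r hrpos _ (by simp), two_mul]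
    _ = ENNReal.ofReal (2 * N * r ^ (-s)) * JJ N hN s := by
        rw [tsum_fintype, Finset.sum_const, Finset.card_univ, Fintype.card_fin, nsmul_eq_mul,
          ENNReal.ofReal_mul (by positivity), ENNReal.ofReal_mul (by positivity)]
        simp
        ring
    _ ≤ _ := by
        refine mul_le_mul_left (ENNReal.ofReal_le_ofReal ?_) _
        nlinarith

lemma lint_rpow (r η : ℝ) (hr : -1 < r) (hη : 0 < η) :
    ∫⁻ t in Ioo 0 η, ENNReal.ofReal (t ^ r) = ENNReal.ofReal (η ^ (r + 1) / (r + 1)) := by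
  have h1 : IntervalIntegrable (fun t : ℝ => t ^ r) volume 0 η :=
    intervalIntegral.intervalIntegrable_rpow' hr
  have h2 : IntegrableOn (fun t : ℝ => t ^ r) (Ioo 0 η) :=
    ((intervalIntegrable_iff_integrableOn_Ioc_of_le hη.le).1 h1).mono_set Ioo_subset_Ioc_self
  rw [← ofReal_integral_eq_lintegral_ofReal h2]
  · rw [← integral_Ioc_eq_integral_Ioo, ← intervalIntegral.integral_of_le hη.le,
      integral_rpow (Or.inl hr), Real.zero_rpow (by linarith), sub_zero]
  · filter_upwards [ae_restrict_mem measurableSet_Ioo] with t ht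
    exact Real.rpow_nonneg ht.1.le _

/-- near-diagonal bound -/
lemma kk_near (N : ℕ) (hN : 0 < N) (s : ℝ) (hs1 : s < 1)
    (g : EuclideanSpace ℝ (Fin N)) :
    ∫⁻ h in {h : EuclideanSpace ℝ (Fin N) | ‖h‖ < 1}, ENNReal.ofReal |inner ℝ g h| * kk N s h
      ≤ ENNReal.ofReal ‖g‖ * (ENNReal.ofReal (2 / (1 - s)) * JJ N hN s) := by
  by_cases hg : g = 0
  · simp [hg]
  have hg0 : 0 < ‖g‖ := norm_pos_iff.2 hg
  set ν := (‖g‖)⁻¹ • g with hν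
  have hν1 : ‖ν‖ = 1 := by rw [hν, norm_smul]; simp [hg]
  have hgν : g = ‖g‖ • ν := by rw [hν, smul_smul, mul_inv_cancel₀ hg0.ne', one_smul]
  have hin : ∀ h, ENNReal.ofReal |inner ℝ g h| * kk N s h =
      ENNReal.ofReal ‖g‖ * (ENNReal.ofReal |inner ℝ ν h| * kk N s h) := by
    intro h
    rw [← mul_assoc, ← ENNReal.ofReal_mul hg0.le]
    congr 2
    nth_rw 1 [hgν]
    rw [real_inner_smul_left, abs_mul, abs_of_pos hg0]
  simp only [hin]
  rw [lintegral_const_mul' _ _ ENNReal.ofReal_ne_top]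
  gcongr
  have key : ∀ h : EuclideanSpace ℝ (Fin N), ‖h‖ < 1 → ENNReal.ofReal |inner ℝ ν h| * kk N s h ≤
      ∫⁻ t in Ioo (0:ℝ) 1, {p : ℝ × EuclideanSpace ℝ (Fin N) | p.1 < |inner ℝ ν p.2|}.indicator
        (fun p => kk N s p.2) (t, h) := by
    intro h hh
    have hle : |inner ℝ ν h| ≤ 1 := by
      have := abs_real_inner_le_norm ν h
      rw [hν1] at this; linarith
    have : ENNReal.ofReal |inner ℝ ν h| * kk N s h =
        ∫⁻ t in Ioo (0:ℝ) (|inner ℝ ν h|), kk N s h := by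
      rw [setLIntegral_const, Real.volume_Ioo, sub_zero, mul_comm]
    rw [this]
    calc _ = ∫⁻ t in Ioo (0:ℝ) (|inner ℝ ν h|),
            {p : ℝ × EuclideanSpace ℝ (Fin N) | p.1 < |inner ℝ ν p.2|}.indicator
            (fun p => kk N s p.2) (t, h) := by
          refine setLIntegral_congr_fun measurableSet_Ioo fun t ht => ?_
          rw [indicator_of_mem]
          exact ht.2
      _ ≤ _ := lintegral_mono_set (Ioo_subset_Ioo_right hle)
  have hmS : MeasurableSet {p : ℝ × EuclideanSpace ℝ (Fin N) | p.1 < |inner ℝ ν p.2|} :=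
    measurableSet_lt (by fun_prop) (by fun_prop)
  have hmf : Measurable ({p : ℝ × EuclideanSpace ℝ (Fin N) | p.1 < |inner ℝ ν p.2|}.indicator
        (fun p => kk N s p.2)) :=
    ((kk_meas N s).comp measurable_snd).indicator hmS
  calc _ ≤ ∫⁻ h in {h : EuclideanSpace ℝ (Fin N) | ‖h‖ < 1}, ∫⁻ t in Ioo (0:ℝ) 1,
        {p : ℝ × EuclideanSpace ℝ (Fin N) | p.1 < |inner ℝ ν p.2|}.indicator
        (fun p => kk N s p.2) (t, h) :=
        setLIntegral_mono' (measurableSet_lt (by fun_prop) (by fun_prop)) fun h hh => key h hh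
    _ ≤ ∫⁻ h, ∫⁻ t in Ioo (0:ℝ) 1,
        {p : ℝ × EuclideanSpace ℝ (Fin N) | p.1 < |inner ℝ ν p.2|}.indicator
        (fun p => kk N s p.2) (t, h) := setLIntegral_le_lintegral _ _
    _ = ∫⁻ t in Ioo (0:ℝ) 1, ∫⁻ h,
        {p : ℝ × EuclideanSpace ℝ (Fin N) | p.1 < |inner ℝ ν p.2|}.indicator
        (fun p => kk N s p.2) (t, h) := by
        rw [lintegral_lintegral_swap]
        exact (hmf.comp measurable_swap).aemeasurable
    _ ≤ ∫⁻ t in Ioo (0:ℝ) 1, ENNReal.ofReal (t ^ (-s)) * (2 * JJ N hN s) := by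
        refine setLIntegral_mono' measurableSet_Ioo fun t ht => ?_
        have hst : MeasurableSet {h : EuclideanSpace ℝ (Fin N) | t < |inner ℝ ν h|} :=
          measurableSet_lt (by fun_prop) (by fun_prop)
        have h1 : ∀ h, {p : ℝ × EuclideanSpace ℝ (Fin N) | p.1 < |inner ℝ ν p.2|}.indicator
          (fun p => kk N s p.2) (t, h) =
          {h : EuclideanSpace ℝ (Fin N) | t < |inner ℝ ν h|}.indicator (kk N s) h := by
          intro h; simp [indicator]
        simp only [h1]
        rw [lintegral_indicator hst]
        have h2 : {h : EuclideanSpace ℝ (Fin N) | t < |inner ℝ ν h|} =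
          {h | t < inner ℝ ν h} ∪ {h | t < inner ℝ (-ν) h} := by
          ext h; simp [lt_abs]
        rw [h2]
        refine (lintegral_union_le _ _ _).trans ?_
        rw [kk_half N hN s t ht.1 _ hν1, kk_half N hN s t ht.1 _ (by simpa using hν1), two_mul,
          mul_add]
    _ = _ := by
        rw [lintegral_mul_const _ (by fun_prop), lint_rpow _ _ (by linarith) one_pos, Real.one_rpow,
          ← mul_assoc]
        congr 1
        rw [show (2 : ℝ≥0∞) = ENNReal.ofReal 2 by simp, ← ENNReal.ofReal_mul]
        · congr 1
          rw [show -s + 1 = 1 - s by ring]; ring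
        · apply div_nonneg zero_le_one; linarith

lemma diff_le_grad (N : ℕ) (v : EuclideanSpace ℝ (Fin N) → ℝ) (hv : ContDiff ℝ (⊤ : ℕ∞) v)
    (h : EuclideanSpace ℝ (Fin N)) :
    ∫⁻ x, ENNReal.ofReal |v x - v (x + h)| ≤ ∫⁻ x, ENNReal.ofReal |fderiv ℝ v x h| := by
  have hc : Continuous (fun x => fderiv ℝ v x h) :=
    (hv.continuous_fderiv (by simp)).clm_apply continuous_const
  have hpt : ∀ x, ENNReal.ofReal |v x - v (x + h)| ≤
      ∫⁻ t in Ioc (0:ℝ) 1, ENNReal.ofReal |fderiv ℝ v (x + t • h) h| := by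
    intro x
    have hd : ∀ t : ℝ, HasDerivAt (fun t : ℝ => v (x + t • h)) (fderiv ℝ v (x + t • h) h) t := by
      intro t
      have h1 : HasDerivAt (fun t : ℝ => x + t • h) h t := by
        simpa using ((hasDerivAt_id t).smul_const h).const_add x
      exact ((hv.differentiable (by simp)).differentiableAt.hasFDerivAt).comp_hasDerivAt t h1
    have hcc : Continuous (fun t : ℝ => fderiv ℝ v (x + t • h) h) :=
      hc.comp (by fun_prop : Continuous (fun t : ℝ => x + t • h))
    have h2 := intervalIntegral.integral_eq_sub_of_hasDerivAt (a := 0) (b := 1)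
      (fun t _ => hd t) (hcc.intervalIntegrable _ _)
    simp only [one_smul, zero_smul, add_zero] at h2
    rw [abs_sub_comm, ← h2, intervalIntegral.integral_of_le zero_le_one]
    simp only [← Real.norm_eq_abs, ofReal_norm]
    exact enorm_integral_le_lintegral_enorm _
  calc _ ≤ ∫⁻ x, ∫⁻ t in Ioc (0:ℝ) 1, ENNReal.ofReal |fderiv ℝ v (x + t • h) h| :=
        lintegral_mono hpt
    _ = ∫⁻ t in Ioc (0:ℝ) 1, ∫⁻ x, ENNReal.ofReal |fderiv ℝ v (x + t • h) h| := by
        rw [lintegral_lintegral_swap]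
        have : Continuous (Function.uncurry fun (x : EuclideanSpace ℝ (Fin N)) (t : ℝ) =>
            ENNReal.ofReal |fderiv ℝ v (x + t • h) h|) :=
          ENNReal.continuous_ofReal.comp ((hc.comp (by fun_prop :
            Continuous (fun p : EuclideanSpace ℝ (Fin N) × ℝ => p.1 + p.2 • h))).abs)
        exact this.measurable.aemeasurable
    _ = ∫⁻ t in Ioc (0:ℝ) 1, ∫⁻ x, ENNReal.ofReal |fderiv ℝ v x h| := by
        congr 1; ext t
        exact lintegral_add_right_eq_self (fun x => ENNReal.ofReal |fderiv ℝ v x h|) (t • h)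
    _ = _ := by simp

lemma diff_le_two (N : ℕ) (v : EuclideanSpace ℝ (Fin N) → ℝ) (hv : Continuous v)
    (h : EuclideanSpace ℝ (Fin N)) :
    ∫⁻ x, ENNReal.ofReal |v x - v (x + h)| ≤ 2 * ∫⁻ x, ENNReal.ofReal |v x| := by
  calc _ ≤ ∫⁻ x, (ENNReal.ofReal |v x| + ENNReal.ofReal |v (x + h)|) := by
        refine lintegral_mono fun x => ?_
        simp only
        rw [← ENNReal.ofReal_add (abs_nonneg _) (abs_nonneg _)]
        exact ENNReal.ofReal_le_ofReal (abs_sub _ _)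
    _ = _ := by
        rw [lintegral_add_left (by fun_prop),
          lintegral_add_right_eq_self (fun x => ENNReal.ofReal |v x|) h, two_mul]

lemma gag_eq2 (N : ℕ) (s : ℝ) (v : EuclideanSpace ℝ (Fin N) → ℝ) (hv : Continuous v) :
    gagliardo N s 1 Set.univ v =
      ∫⁻ h, (∫⁻ x, ENNReal.ofReal |v x - v (x + h)|) * kk N s h := by
  rw [gag_eq]
  have hk := kk_meas N s
  calc _ = ∫⁻ x, ∫⁻ h, ENNReal.ofReal |v x - v (x + h)| * kk N s h := by
        congr 1; ext x
        rw [← lintegral_add_left_eq_self _ x]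
        congr 1; ext h
        rw [show x - (x + h) = -h by abel, kk_neg]
    _ = ∫⁻ h, ∫⁻ x, ENNReal.ofReal |v x - v (x + h)| * kk N s h := by
        rw [lintegral_lintegral_swap]
        refine Measurable.aemeasurable ?_
        unfold Function.uncurry
        have : Measurable v := hv.measurable
        fun_prop
    _ = _ := by
        congr 1; ext h
        rw [lintegral_mul_const]
        have : Measurable v := hv.measurable
        fun_prop

lemma gag_le (N : ℕ) (hN : 0 < N) (s : ℝ) (hs : 0 < s) (hs1 : s < 1)
    (v : EuclideanSpace ℝ (Fin N) → ℝ) (hv : ContDiff ℝ (⊤ : ℕ∞) v) :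
    gagliardo N s 1 Set.univ v ≤
      (∫⁻ x, ENNReal.ofReal ‖fderiv ℝ v x‖) * (ENNReal.ofReal (2 / (1 - s)) * JJ N hN s)
      + (2 * ∫⁻ x, ENNReal.ofReal |v x|) * (ENNReal.ofReal (4 * N ^ 2) * JJ N hN s) := by
  have hk := kk_meas N s
  have hcf : Continuous (fderiv ℝ v) := hv.continuous_fderiv (by simp)
  have hS : MeasurableSet {h : EuclideanSpace ℝ (Fin N) | ‖h‖ < 1} :=
    measurableSet_lt (by fun_prop) (by fun_prop)
  rw [gag_eq2 N s v hv.continuous, ← lintegral_add_compl _ hS]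
  refine add_le_add ?_ ?_
  · calc _ ≤ ∫⁻ h in {h : EuclideanSpace ℝ (Fin N) | ‖h‖ < 1},
          ∫⁻ x, ENNReal.ofReal |fderiv ℝ v x h| * kk N s h := by
          refine lintegral_mono fun h => ?_
          simp only
          rw [lintegral_mul_const]
          · exact mul_le_mul_left (diff_le_grad N v hv h) _
          · have : Continuous (fun x => fderiv ℝ v x h) := hcf.clm_apply continuous_const
            exact (ENNReal.continuous_ofReal.comp this.abs).measurable
      _ = ∫⁻ x, ∫⁻ h in {h : EuclideanSpace ℝ (Fin N) | ‖h‖ < 1},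
          ENNReal.ofReal |fderiv ℝ v x h| * kk N s h := by
          rw [lintegral_lintegral_swap]
          have : Continuous (fun p : EuclideanSpace ℝ (Fin N) × EuclideanSpace ℝ (Fin N) =>
            ENNReal.ofReal |fderiv ℝ v p.2 p.1|) :=
            ENNReal.continuous_ofReal.comp (((hcf.comp continuous_snd).clm_apply continuous_fst).abs)
          exact (this.measurable.mul (hk.comp measurable_fst)).aemeasurable
      _ ≤ ∫⁻ x, ENNReal.ofReal ‖fderiv ℝ v x‖ * (ENNReal.ofReal (2 / (1 - s)) * JJ N hN s) := by
          refine lintegral_mono fun x => ?_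
          have h1 := kk_near N hN s hs1 ((InnerProductSpace.toDual ℝ _).symm (fderiv ℝ v x))
          simpa using h1
      _ = _ := by
          rw [lintegral_mul_const]
          exact (ENNReal.continuous_ofReal.comp hcf.norm).measurable
  · have hcompl : {h : EuclideanSpace ℝ (Fin N) | ‖h‖ < 1}ᶜ = {h | 1 ≤ ‖h‖} := by
      ext h; simp
    rw [hcompl]
    calc _ ≤ ∫⁻ h in {h : EuclideanSpace ℝ (Fin N) | 1 ≤ ‖h‖},
          (2 * ∫⁻ x, ENNReal.ofReal |v x|) * kk N s h := by
          refine lintegral_mono fun h => ?_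
          simp only
          gcongr
          exact diff_le_two N v hv.continuous h
      _ = (2 * ∫⁻ x, ENNReal.ofReal |v x|) *
          ∫⁻ h in {h : EuclideanSpace ℝ (Fin N) | 1 ≤ ‖h‖}, kk N s h := by
          rw [lintegral_const_mul _ hk]
      _ ≤ _ := by
          gcongr
          exact kk_tail N hN s hs hs1

lemma hardy_ge (N : ℕ) (s : ℝ) (Ω : Set (EuclideanSpace ℝ (Fin N))) (c : ℝ≥0∞)
    (H : ∀ u : EuclideanSpace ℝ (Fin N) → ℝ, ContDiff ℝ (⊤ : ℕ∞) u → HasCompactSupport u →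
      tsupport u ⊆ Ω →
      c * ∫⁻ x in Ω, ENNReal.ofReal |u x| *
        ENNReal.ofReal (Metric.infDist x (frontier Ω) ^ (-s)) ≤ gagliardo N s 1 Set.univ u) :
    c ≤ hardyConst N s 1 Ω := by
  refine le_sInf ?_
  rintro _ ⟨u, hu, hc, ht, h1, rfl⟩
  have hint : Integrable (fun x => |u x| ^ (1:ℝ) / Metric.infDist x (frontier Ω) ^ (s * 1))
      (volume.restrict Ω) := by
    by_contra hcon
    rw [integral_undef hcon] at h1
    exact zero_ne_one h1
  have h2 := ofReal_integral_eq_lintegral_ofReal hint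
    (Eventually.of_forall fun x => div_nonneg (Real.rpow_nonneg (abs_nonneg _) _)
      (Real.rpow_nonneg infDist_nonneg _))
  rw [h1, ENNReal.ofReal_one] at h2
  have h3 := H u hu hc ht
  have h4 : ∫⁻ x in Ω, ENNReal.ofReal |u x| *
        ENNReal.ofReal (Metric.infDist x (frontier Ω) ^ (-s)) = 1 := by
    rw [h2]
    congr 1; ext x
    rw [← ENNReal.ofReal_mul (abs_nonneg _), Real.rpow_neg infDist_nonneg, Real.rpow_one, mul_one]
    rfl
  rwa [h4, mul_one] at h3

lemma infDist_frontier_eq (N : ℕ) (Ω : Set (EuclideanSpace ℝ (Fin N))) (hop : IsOpen Ω)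
    (hne : Ω ≠ univ) (x : EuclideanSpace ℝ (Fin N)) (hx : x ∈ Ω) :
    infDist x (frontier Ω) = infDist x Ωᶜ := by
  obtain ⟨y, hy, hxy⟩ := exists_mem_frontier_infDist_compl_eq_dist hx hne
  refine le_antisymm ?_ ?_
  · rw [hxy]; exact infDist_le_dist_of_mem hy
  · refine infDist_le_infDist_of_subset ?_ ⟨y, hy⟩
    intro z hz
    rw [hop.frontier_eq] at hz
    exact hz.2

lemma kk_trans (N : ℕ) (hN : 0 < N) (s t : ℝ) (ht : 0 < t) (ν x : EuclideanSpace ℝ (Fin N))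
    (hν : ‖ν‖ = 1) :
    ∫⁻ y in {y : EuclideanSpace ℝ (Fin N) | t < inner ℝ ν (y - x)}, kk N s (x - y)
      = ENNReal.ofReal (t ^ (-s)) * JJ N hN s := by
  rw [← kk_half N hN s t ht ν hν]
  have h1 := (measurePreserving_add_left (volume : Measure (EuclideanSpace ℝ (Fin N))) x).setLIntegral_comp_preimage_emb
    (Homeomorph.addLeft x).measurableEmbedding (fun y => kk N s (x - y))
    {y : EuclideanSpace ℝ (Fin N) | t < inner ℝ ν (y - x)}
  rw [← h1]
  have : (fun h => x + h) ⁻¹' {y : EuclideanSpace ℝ (Fin N) | t < inner ℝ ν (y - x)}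
    = {h | t < inner ℝ ν h} := by ext h; simp
  rw [this]
  congr 1; ext h
  rw [show x - (x + h) = -h by abel, kk_neg]

lemma convex_pot (N : ℕ) (hN : 0 < N) (s : ℝ)
    (Ω : Set (EuclideanSpace ℝ (Fin N))) (hop : IsOpen Ω)
    (hconv : Convex ℝ Ω) (hne : Ω ≠ univ) (x : EuclideanSpace ℝ (Fin N)) (hx : x ∈ Ω) :
    ENNReal.ofReal (Metric.infDist x (frontier Ω) ^ (-s)) * JJ N hN s ≤
      ∫⁻ y in Ωᶜ, kk N s (x - y) := by
  obtain ⟨y0, hy0, hxy0⟩ := exists_mem_frontier_infDist_compl_eq_dist hx hne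
  rw [infDist_frontier_eq N Ω hop hne x hx]
  have hy0' : y0 ∉ Ω := by rw [hop.frontier_eq] at hy0; exact hy0.2
  have hd : 0 < infDist x Ωᶜ := by
    rw [hxy0, dist_pos]; rintro rfl; exact hy0' hx
  obtain ⟨f, hf⟩ := geometric_hahn_banach_open_point hconv hop hy0'
  set g := (InnerProductSpace.toDual ℝ _).symm f with hg
  have hfg : ∀ y, f y = inner ℝ g y := fun y => by simp [hg]
  have hg0 : g ≠ 0 := by
    intro h0
    have := hf x hx
    simp [hfg, h0] at this
  have hgp : 0 < ‖g‖ := norm_pos_iff.2 hg0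
  set ν := (‖g‖)⁻¹ • g with hν
  have hν1 : ‖ν‖ = 1 := by rw [hν, norm_smul]; simp [hg0]
  rw [← kk_trans N hN s _ hd ν x hν1]
  refine lintegral_mono_set ?_
  intro y hy hyΩ
  simp only [mem_ofPred_eq] at hy
  have h1 := hf y hyΩ
  rw [hfg, hfg] at h1
  have h2 : inner ℝ ν y < inner ℝ ν y0 := by
    rw [hν, real_inner_smul_left, real_inner_smul_left]
    exact mul_lt_mul_of_pos_left h1 (inv_pos.2 hgp)
  have h3 : inner ℝ ν (y0 - x) ≤ infDist x Ωᶜ := by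
    refine (real_inner_le_norm _ _).trans ?_
    rw [hν1, one_mul, hxy0, dist_comm, dist_eq_norm]
  rw [inner_sub_right] at hy h3
  linarith

lemma gag_ge_compl (N : ℕ) (s : ℝ) (Ω : Set (EuclideanSpace ℝ (Fin N))) (hm : MeasurableSet Ω)
    (u : EuclideanSpace ℝ (Fin N) → ℝ) (hu : Continuous u) (hz : ∀ x, x ∉ Ω → u x = 0) :
    2 * ∫⁻ x in Ω, ENNReal.ofReal |u x| * ∫⁻ y in Ωᶜ, kk N s (x - y) ≤
      gagliardo N s 1 Set.univ u := by
  have hk := kk_meas N s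
  have hum := hu.measurable
  rw [gag_eq, ← lintegral_add_compl
    (fun x => ∫⁻ y, ENNReal.ofReal |u x - u y| * kk N s (x - y)) hm, two_mul]
  have h1 : ∫⁻ x in Ω, ENNReal.ofReal |u x| * ∫⁻ y in Ωᶜ, kk N s (x - y) =
      ∫⁻ x in Ω, ∫⁻ y in Ωᶜ, ENNReal.ofReal |u x| * kk N s (x - y) := by
    congr 1; ext x
    rw [lintegral_const_mul _ (by fun_prop)]
  refine add_le_add ?_ ?_
  · rw [h1]
    refine lintegral_mono fun x => ?_
    refine le_trans ?_ (setLIntegral_le_lintegral Ωᶜ _)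
    refine setLIntegral_mono' hm.compl fun y hy => ?_
    rw [hz y hy, sub_zero]
  · rw [h1, lintegral_lintegral_swap]
    · refine setLIntegral_mono' hm.compl fun y hy => ?_
      refine le_trans ?_ (setLIntegral_le_lintegral Ω _)
      refine setLIntegral_mono' hm fun x hx => ?_
      rw [hz y hy, zero_sub, abs_neg, ← kk_neg, neg_sub]
    · refine Measurable.aemeasurable ?_
      unfold Function.uncurry
      fun_prop

lemma hardy_convex_ge (N : ℕ) (hN : 0 < N) (s : ℝ)
    (Ω : Set (EuclideanSpace ℝ (Fin N))) (hop : IsOpen Ω)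
    (hconv : Convex ℝ Ω) (hne : Ω ≠ univ) :
    2 * JJ N hN s ≤ hardyConst N s 1 Ω := by
  refine hardy_ge N s Ω _ fun u hu hc ht => ?_
  refine le_trans ?_ (gag_ge_compl N s Ω hop.measurableSet u hu.continuous
    fun x hx => image_eq_zero_of_notMem_tsupport fun h => hx (ht h))
  rw [mul_assoc]
  gcongr
  rw [← lintegral_const_mul]
  · refine setLIntegral_mono' hop.measurableSet fun x hx => ?_
    rw [mul_left_comm, mul_comm (JJ N hN s)]
    gcongr
    exact convex_pot N hN s Ω hop hconv hne x hx
  · have := hu.continuous.measurable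
    have h2 : Measurable fun x => infDist x (frontier Ω) := (continuous_infDist_pt _).measurable
    fun_prop

lemma halfSpace_open (N : ℕ) (hN : 0 < N) : IsOpen (halfSpace N hN) :=
  isOpen_lt continuous_const (by fun_prop)

lemma halfSpace_ne (N : ℕ) (hN : 0 < N) : halfSpace N hN ≠ univ := by
  intro h
  have : (0 : EuclideanSpace ℝ (Fin N)) ∈ halfSpace N hN := h ▸ mem_univ _
  simp [halfSpace] at this

lemma halfSpace_infDist (N : ℕ) (hN : 0 < N) (x : EuclideanSpace ℝ (Fin N))
    (hx : x ∈ halfSpace N hN) : infDist x (frontier (halfSpace N hN)) = x ⟨0, hN⟩ := by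
  rw [infDist_frontier_eq N _ (halfSpace_open N hN) (halfSpace_ne N hN) x hx]
  have hx' : 0 < x ⟨0, hN⟩ := hx
  refine le_antisymm ?_ ?_
  · set z := x - EuclideanSpace.single ⟨0, hN⟩ (x ⟨0, hN⟩) with hz
    have hzm : z ∈ (halfSpace N hN)ᶜ := by simp [hz, halfSpace]
    refine (infDist_le_dist_of_mem hzm).trans ?_
    rw [dist_eq_norm, hz]
    simp [abs_of_pos hx']
  · rw [le_infDist (nonempty_compl.2 (halfSpace_ne N hN))]
    intro y hy
    have hy' : y ⟨0, hN⟩ ≤ 0 := by simpa [halfSpace] using hy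
    have := PiLp.norm_apply_le (x - y) ⟨0, hN⟩
    rw [dist_eq_norm]
    rw [Real.norm_eq_abs] at this
    have h2 := le_abs_self ((x - y) ⟨0, hN⟩)
    simp only [PiLp.sub_apply] at this h2
    linarith

set_option maxHeartbeats 1000000 in
lemma hardy_half_ge (N : ℕ) (hN : 0 < N) (s : ℝ) (hs : 0 < s) :
    4 * JJ N hN s ≤ hardyConst N s 1 (halfSpace N hN) := by
  classical
  refine hardy_ge N s _ _ fun u hu hc ht => ?_
  have hk := kk_meas N s
  have hum := hu.continuous.measurable
  set z : Fin N := ⟨0, hN⟩ with hzdef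
  obtain ⟨ε', hε', hmin⟩ := hc.isCompact.exists_forall_le' (f := fun x => x z) (a := 0)
    (by fun_prop) (fun x hx => ht hx)
  set ε := ε' / 2 with hεdef
  have hε : 0 < ε := by positivity
  have hu0 : ∀ x, u x ≠ 0 → ε < x z := fun x hx => by
    have := hmin x (subset_tsupport _ hx)
    linarith
  set J := JJ N hN s with hJ
  have hJfin : J ≠ ⊤ := JJ_fin N hN s hs
  set W : EuclideanSpace ℝ (Fin N) → ℝ≥0∞ := fun x => ENNReal.ofReal |u x| with hW
  have hWm : Measurable W := by fun_prop
  set T : EuclideanSpace ℝ (Fin N) → ℝ≥0∞ := fun x => ENNReal.ofReal ((x z) ^ (-s)) * J with hT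
  have hTm : Measurable T := by fun_prop
  set Jε := ENNReal.ofReal (ε ^ (-s)) * J with hJε
  set D : Set (EuclideanSpace ℝ (Fin N) × EuclideanSpace ℝ (Fin N)) :=
    {p | 0 < p.1 z ∧ (p.1 z + ε < p.2 z ∨ p.2 z ≤ 0)} with hD
  have hDm : MeasurableSet D := by
    refine MeasurableSet.inter (s₁ := {p : EuclideanSpace ℝ (Fin N) × EuclideanSpace ℝ (Fin N) |
      0 < p.1 z}) (s₂ := {p | (p.1 z + ε < p.2 z ∨ p.2 z ≤ 0)}) ?_ (MeasurableSet.union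
      (s₁ := {p : EuclideanSpace ℝ (Fin N) × EuclideanSpace ℝ (Fin N) | p.1 z + ε < p.2 z})
      (s₂ := {p | p.2 z ≤ 0}) ?_ ?_)
    · exact measurableSet_lt (by fun_prop) (by fun_prop)
    · exact measurableSet_lt (by fun_prop) (by fun_prop)
    · exact measurableSet_le (by fun_prop) (by fun_prop)
  set χ : EuclideanSpace ℝ (Fin N) → EuclideanSpace ℝ (Fin N) → ℝ≥0∞ :=
    fun x y => D.indicator 1 (x, y) with hχ
  have hχm : Measurable (fun p : EuclideanSpace ℝ (Fin N) × EuclideanSpace ℝ (Fin N) => χ p.1 p.2) :=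
    measurable_one.indicator hDm
  have hχm1 : ∀ x, Measurable (χ x) := fun x => hχm.comp measurable_prodMk_left
  have hχm2 : ∀ y, Measurable (fun x => χ x y) :=
    fun y => hχm.comp measurable_prodMk_right
  have hχ1 : ∀ x y, χ x y + χ y x ≤ 1 := by
    intro x y
    simp only [hχ, indicator, hD, mem_ofPred_eq, Pi.one_apply]
    split_ifs with h1 h2 h2
    · exfalso
      rcases h1 with ⟨a, b | b⟩ <;> rcases h2 with ⟨c, d | d⟩ <;> linarith
    all_goals simp
  set F : EuclideanSpace ℝ (Fin N) → EuclideanSpace ℝ (Fin N) → ℝ≥0∞ :=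
    fun x y => ENNReal.ofReal |u x - u y| * kk N s (x - y) with hF
  have hFs : ∀ x y, F x y = F y x := by
    intro x y
    simp only [hF]
    rw [abs_sub_comm, ← kk_neg, neg_sub]
  have hFm : Measurable (fun p : EuclideanSpace ℝ (Fin N) × EuclideanSpace ℝ (Fin N) => F p.1 p.2) := by
    simp only [hF]; fun_prop
  clear_value W T χ F J Jε
  have hFχ : Measurable (fun p : EuclideanSpace ℝ (Fin N) × EuclideanSpace ℝ (Fin N) =>
      F p.1 p.2 * χ p.1 p.2) := hFm.mul hχm
  have hFχx : ∀ x, Measurable (fun y => F x y * χ x y) :=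
    fun x => hFχ.comp measurable_prodMk_left
  have hFχo : Measurable (fun x => ∫⁻ y, F x y * χ x y) := hFχ.lintegral_prod_right'
  have hkχm : Measurable (fun p : EuclideanSpace ℝ (Fin N) × EuclideanSpace ℝ (Fin N) =>
      kk N s (p.1 - p.2) * χ p.1 p.2) :=
    (hk.comp (measurable_fst.sub measurable_snd)).mul hχm
  have hkχx : ∀ x : EuclideanSpace ℝ (Fin N), Measurable (fun y : EuclideanSpace ℝ (Fin N) => kk N s (x - y) * χ x y) :=
    fun x => (hk.comp (measurable_const.sub measurable_id)).mul (hχm1 x)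
  have hkχy : ∀ y : EuclideanSpace ℝ (Fin N), Measurable (fun x : EuclideanSpace ℝ (Fin N) => kk N s (x - y) * χ x y) :=
    fun y => (hk.comp (measurable_id.sub measurable_const)).mul (hχm2 y)
  -- step 1
  have step1 : 2 * ∫⁻ x, ∫⁻ y, F x y * χ x y ≤ gagliardo N s 1 univ u := by
    rw [gag_eq]
    have hsw : ∫⁻ x, ∫⁻ y, F x y * χ x y = ∫⁻ x, ∫⁻ y, F x y * χ y x := by
      rw [lintegral_lintegral_swap hFχ.aemeasurable]
      congr 1; ext x; congr 1; ext y
      rw [hFs]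
    rw [two_mul]
    nth_rw 2 [hsw]
    rw [← lintegral_add_left hFχo]
    refine lintegral_mono fun x => ?_
    simp only
    rw [← lintegral_add_left (hFχx x)]
    refine lintegral_mono fun y => ?_
    simp only
    rw [← mul_add]
    exact (mul_le_mul_right (hχ1 x y) _).trans (by simp [hF])
  set G : EuclideanSpace ℝ (Fin N) → ℝ≥0∞ := fun y => ∫⁻ x, kk N s (x - y) * χ x y with hG
  set Q : EuclideanSpace ℝ (Fin N) → ℝ≥0∞ := fun x => ∫⁻ y, kk N s (x - y) * χ x y with hQ
  have hGm : Measurable G := (hkχm.comp measurable_swap).lintegral_prod_right'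
  clear_value G Q
  have step2 : ∫⁻ x, W x * Q x ≤ (∫⁻ x, ∫⁻ y, F x y * χ x y) + ∫⁻ y, W y * G y := by
    have e1 : ∫⁻ y, W y * G y = ∫⁻ x, ∫⁻ y, W y * (kk N s (x - y) * χ x y) := by
      rw [lintegral_lintegral_swap (by
        exact ((hWm.comp measurable_snd).mul hkχm).aemeasurable)]
      congr 1; ext y
      rw [hG, lintegral_const_mul]
      exact hkχy y
    rw [e1, ← lintegral_add_left hFχo]
    refine lintegral_mono fun x => ?_
    simp only
    rw [← lintegral_add_left (hFχx x), hQ,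
      ← lintegral_const_mul _ (hkχx x)]
    refine lintegral_mono fun y => ?_
    simp only [hF]
    rw [mul_assoc, ← add_mul]
    refine mul_le_mul_left ?_ _
    simp only [hW]
    rw [← ENNReal.ofReal_add (abs_nonneg _) (abs_nonneg _)]
    refine ENNReal.ofReal_le_ofReal ?_
    have := abs_add_le (u x - u y) (u y)
    simpa using this
  set e : EuclideanSpace ℝ (Fin N) := EuclideanSpace.single z 1 with he
  have he1 : ‖e‖ = 1 := by simp [he]
  have he1' : ‖-e‖ = 1 := by simp [he]
  have hie : ∀ y, inner ℝ e y = y z := fun y => by simp [he, EuclideanSpace.inner_single_left]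
  have hSm : ∀ (a : EuclideanSpace ℝ (Fin N)) (r : ℝ) (b : EuclideanSpace ℝ (Fin N)),
    MeasurableSet {y : EuclideanSpace ℝ (Fin N) | r < inner ℝ a (y - b)} :=
    fun a r b => measurableSet_lt (by fun_prop) (by fun_prop)
  have hQge : ∀ x, 0 < x z → Jε + T x ≤ Q x := by
    intro x hx
    simp only [hJε, hT, hJ]
    rw [← kk_trans N hN s ε hε e x he1, ← kk_trans N hN s (x z) hx (-e) x he1',
      ← lintegral_union (hSm _ _ _)]
    · rw [hQ, ← lintegral_indicator ((hSm _ _ _).union (hSm _ _ _))]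
      refine lintegral_mono fun y => ?_
      by_cases hy : y ∈ {y | ε < inner ℝ e (y - x)} ∪ {y | x z < inner ℝ (-e) (y - x)}
      swap
      · rw [indicator_of_notMem hy]; exact bot_le
      rw [indicator_of_mem hy]
      have : χ x y = 1 := by
        simp only [hχ]
        rw [indicator_of_mem]; · rfl
        simp only [mem_union, mem_ofPred_eq, inner_neg_left, hie, PiLp.sub_apply] at hy
        refine ⟨hx, hy.imp (fun h => ?_) (fun h => ?_)⟩ <;> simp only <;> linarith
      rw [this, mul_one]
    · rw [disjoint_left]
      intro y hy hy'
      simp only [mem_ofPred_eq, inner_neg_left, hie] at hy hy'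
      linarith
  have hGle : ∀ y, ε < y z → G y + T y ≤ Jε := by
    intro y hy
    have hy0 : 0 < y z := hε.trans hy
    simp only [hJε, hT, hJ]
    rw [← kk_trans N hN s ε hε (-e) y he1', ← kk_trans N hN s (y z) hy0 (-e) y he1',
      ← lintegral_indicator (hSm _ _ _), ← lintegral_indicator (hSm _ _ _), hG,
      ← lintegral_add_left (hkχy y)]
    refine lintegral_mono fun x => ?_
    simp only [hχ, indicator, hD, mem_ofPred_eq, Pi.one_apply, inner_neg_left, hie, PiLp.sub_apply]
    rw [show kk N s (x - y) = kk N s (y - x) by rw [← kk_neg, neg_sub]]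
    by_cases h1 : y z < -(x z - y z)
    · rw [if_neg, if_pos h1, if_pos (by linarith)]
      · simp
      · rintro ⟨h2, -⟩; linarith
    · rw [if_neg h1]
      split_ifs with h2 h3 h3
      · simp
      · exfalso
        rcases h2 with ⟨a, b | b⟩ <;> apply h3 <;> linarith
      · simp
      · simp
  have hWz : ∀ x, ¬ ε < x z → W x = 0 := fun x hx => by
    have : u x = 0 := by
      by_contra h; exact hx (hu0 x h)
    simp [hW, this]
  have step3 : (∫⁻ x, W x * G x) + 2 * ∫⁻ x, W x * T x ≤ ∫⁻ x, W x * Q x := by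
    rw [← lintegral_const_mul _ (by fun_prop), ← lintegral_add_left (by fun_prop)]
    refine lintegral_mono fun x => ?_
    simp only
    by_cases hx : ε < x z
    · calc W x * G x + 2 * (W x * T x) = W x * ((G x + T x) + T x) := by ring
        _ ≤ W x * (Jε + T x) := by gcongr; exact hGle x hx
        _ ≤ _ := by gcongr; exact hQge x (hε.trans hx)
    · simp [hWz x hx]
  have hfin : ∫⁻ x, W x * G x ≠ ⊤ := by
    have hWfin : ∫⁻ x, W x ≠ ⊤ := by
      have := (hu.continuous.integrable_of_hasCompactSupport hc (μ := volume)).norm.lintegral_lt_top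
      simpa [hW] using this.ne
    refine ne_of_lt (lt_of_le_of_lt (b := ∫⁻ x, W x * Jε) ?_ ?_)
    · refine lintegral_mono fun x => ?_
      simp only
      by_cases hx : ε < x z
      · gcongr
        exact le_self_add.trans (hGle x hx)
      · simp [hWz x hx]
    · rw [lintegral_mul_const _ hWm]
      rw [hJε]
      exact ENNReal.mul_lt_top hWfin.lt_top (ENNReal.mul_lt_top ENNReal.ofReal_lt_top hJfin.lt_top)
  have step4 : 2 * ∫⁻ x, W x * T x ≤ ∫⁻ x, ∫⁻ y, F x y * χ x y := by
    have := step3.trans step2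
    rw [add_comm (∫⁻ x, ∫⁻ y, F x y * χ x y)] at this
    exact (ENNReal.add_le_add_iff_left hfin).1 this
  calc _ = 2 * (2 * ∫⁻ x in halfSpace N hN, W x * T x) := by
        rw [← mul_assoc, show (2 : ℝ≥0∞) * 2 = 4 by norm_num, mul_assoc, ← lintegral_const_mul']
        · congr 1
          refine setLIntegral_congr_fun (halfSpace_open N hN).measurableSet fun x hx => ?_
          rw [halfSpace_infDist N hN x hx]
          simp only [hT, hW]; ring
        · exact hJfin
    _ ≤ 2 * (2 * ∫⁻ x, W x * T x) := by
        gcongr; exact Measure.restrict_le_self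
    _ ≤ 2 * ∫⁻ x, ∫⁻ y, F x y * χ x y := by gcongr
    _ ≤ _ := step1

section
open scoped Convolution

lemma mollify (N : ℕ) (ρ : EuclideanSpace ℝ (Fin N) → ℝ) (hρ : LipschitzWith 1 ρ) (t δ : ℝ)
    (ht : 0 < t) (hδ : 0 < δ) (hδ1 : δ < 1 / 4) :
    ∃ v : EuclideanSpace ℝ (Fin N) → ℝ, ContDiff ℝ (⊤ : ℕ∞) v ∧ (∀ x, 0 ≤ v x) ∧ (∀ x, v x ≤ 1) ∧
      (∀ x, ρ x ≤ δ * t → v x = 0) ∧ (∀ x, t ≤ ρ x → v x = 1) ∧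
      ∀ x, ‖fderiv ℝ v x‖ ≤ 1 / ((1 - 3 * δ) * t) := by
  have hb : 0 < (1 - 3 * δ) * t := by nlinarith
  have hδt : 0 < δ * t := by positivity
  set b := (1 - 3 * δ) * t with hbdef
  set g : EuclideanSpace ℝ (Fin N) → ℝ := fun x => (ρ x - 2 * δ * t) / b with hg
  have hgl : LipschitzWith (Real.toNNReal (1 / b)) g := by
    refine LipschitzWith.of_dist_le_mul fun x y => ?_
    have h1 := hρ.dist_le_mul x y
    rw [Real.coe_toNNReal _ (by positivity)]
    simp only [NNReal.coe_one, one_mul, Real.dist_eq] at h1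
    rw [Real.dist_eq, hg, ← sub_div, abs_div, abs_of_pos hb, div_le_iff₀ hb]
    calc _ = |ρ x - ρ y| := by congr 1; ring
      _ ≤ _ := h1
      _ = _ := by field_simp
  set f : EuclideanSpace ℝ (Fin N) → ℝ := fun x => max 0 (min 1 (g x)) with hf
  have hfl : LipschitzWith (Real.toNNReal (1 / b)) f := (hgl.const_min 1).const_max 0
  have hf0 : ∀ x, 0 ≤ f x := fun x => le_max_left _ _
  have hf1 : ∀ x, f x ≤ 1 := fun x => max_le zero_le_one (min_le_left _ _)
  have hρb : ∀ x, ∀ y ∈ ball x (δ * t), |ρ y - ρ x| < δ * t := by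
    intro x y hy
    have h1 := hρ.dist_le_mul y x
    simp only [NNReal.coe_one, one_mul, Real.dist_eq] at h1
    exact lt_of_le_of_lt h1 hy
  have hfz : ∀ x, ρ x ≤ 2 * δ * t → f x = 0 := fun x hx => by
    have : g x ≤ 0 := div_nonpos_of_nonpos_of_nonneg (by linarith) hb.le
    exact max_eq_left ((min_le_right _ _).trans this)
  have hfo : ∀ x, (1 - δ) * t ≤ ρ x → f x = 1 := fun x hx => by
    have : 1 ≤ g x := by
      rw [hg, le_div_iff₀ hb, hbdef]; nlinarith
    simp only [hf]
    rw [min_eq_left this, max_eq_right zero_le_one]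
  let φ : ContDiffBump (0 : EuclideanSpace ℝ (Fin N)) := ⟨δ * t / 2, δ * t, by positivity, by linarith⟩
  have hrO : φ.rOut = δ * t := rfl
  set v := (φ.normed volume) ⋆[ContinuousLinearMap.lsmul ℝ ℝ, volume] f with hv
  have hvx : ∀ x, v x = ∫ τ, φ.normed volume τ * f (x - τ) := fun x => by
    rw [hv, convolution_def]; rfl
  have hint : ∀ x, Integrable (fun τ => φ.normed volume τ * f (x - τ)) := by
    intro x
    refine Continuous.integrable_of_hasCompactSupport ?_ ?_
    · exact (φ.continuous_normed).mul (hfl.continuous.comp (by fun_prop))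
    · exact φ.hasCompactSupport_normed.mul_right
  have hφi : ∫ τ, φ.normed volume τ = 1 := φ.integral_normed
  have hvs : ContDiff ℝ (⊤ : ℕ∞) v :=
    φ.hasCompactSupport_normed.contDiff_convolution_left _ φ.contDiff_normed
      hfl.continuous.locallyIntegrable
  refine ⟨v, hvs, ?_, ?_, ?_, ?_, ?_⟩
  · intro x
    rw [hvx]
    exact integral_nonneg fun τ => mul_nonneg (φ.nonneg_normed _) (hf0 _)
  · intro x
    rw [hvx, ← hφi]
    refine integral_mono (hint x) φ.integrable_normed fun τ => ?_
    exact mul_le_of_le_one_right (φ.nonneg_normed _) (hf1 _)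
  · intro x hx
    rw [hv, φ.normed_convolution_eq_right]
    · exact hfz x (by linarith)
    · intro y hy
      have := abs_lt.1 (hρb x y hy)
      rw [hfz x (by linarith), hfz y (by linarith)]
  · intro x hx
    rw [hv, φ.normed_convolution_eq_right]
    · exact hfo x (by linarith)
    · intro y hy
      have := abs_lt.1 (hρb x y hy)
      rw [hfo x (by linarith), hfo y (by linarith)]
  · intro x
    have hvl : LipschitzWith (Real.toNNReal (1 / b)) v := by
      refine LipschitzWith.of_dist_le_mul fun x y => ?_
      rw [Real.dist_eq, hvx, hvx, ← integral_sub (hint x) (hint y), ← Real.norm_eq_abs]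
      calc _ ≤ ∫ τ, φ.normed volume τ * ((Real.toNNReal (1 / b)) * dist x y) := by
            refine norm_integral_le_of_norm_le (φ.integrable_normed.mul_const _) ?_
            refine Eventually.of_forall fun τ => ?_
            rw [← mul_sub, norm_mul, Real.norm_of_nonneg (φ.nonneg_normed _)]
            refine mul_le_mul_of_nonneg_left ?_ (φ.nonneg_normed _)
            have := hfl.dist_le_mul (x - τ) (y - τ)
            rwa [dist_sub_right, Real.dist_eq] at this
        _ = _ := by rw [integral_mul_const, hφi, one_mul]
    have := norm_fderiv_le_of_lipschitz ℝ hvl (x₀ := x)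
    rwa [Real.coe_toNNReal _ (by positivity)] at this

lemma hardy_le (N : ℕ) (s : ℝ) (Ω : Set (EuclideanSpace ℝ (Fin N)))
    (v : EuclideanSpace ℝ (Fin N) → ℝ) (hv : ContDiff ℝ (⊤ : ℕ∞) v) (hc : HasCompactSupport v)
    (ht : tsupport v ⊆ Ω)
    (hint : Integrable (fun x => |v x| / Metric.infDist x (frontier Ω) ^ s) (volume.restrict Ω)) :
    hardyConst N s 1 Ω * ∫⁻ x in Ω, ENNReal.ofReal (|v x| / Metric.infDist x (frontier Ω) ^ s)
      ≤ gagliardo N s 1 Set.univ v := by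
  have hnn : ∀ x, 0 ≤ |v x| / Metric.infDist x (frontier Ω) ^ s := fun x =>
    div_nonneg (abs_nonneg _) (Real.rpow_nonneg infDist_nonneg _)
  rw [← ofReal_integral_eq_lintegral_ofReal hint (Eventually.of_forall hnn)]
  set I := ∫ x in Ω, |v x| / Metric.infDist x (frontier Ω) ^ s with hI
  have hI0 : 0 ≤ I := integral_nonneg hnn
  rcases hI0.eq_or_lt with h0 | h0
  · rw [← h0]; simp
  have hle : hardyConst N s 1 Ω ≤ gagliardo N s 1 Set.univ (fun x => I⁻¹ * v x) := by
    refine sInf_le ⟨fun x => I⁻¹ * v x, contDiff_const.mul hv, hc.mul_left, ?_, ?_, rfl⟩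
    · exact (tsupport_mul_subset_right).trans ht
    · simp only [Real.rpow_one, mul_one, abs_mul, mul_div_assoc]
      rw [integral_const_mul, ← hI, abs_of_pos (by positivity), inv_mul_cancel₀ h0.ne']
  have hsc : gagliardo N s 1 Set.univ (fun x => I⁻¹ * v x) =
      ENNReal.ofReal I⁻¹ * gagliardo N s 1 Set.univ v := by
    rw [gag_eq, gag_eq, ← lintegral_const_mul' _ _ ENNReal.ofReal_ne_top]
    congr 1; ext x
    rw [← lintegral_const_mul' _ _ ENNReal.ofReal_ne_top]
    congr 1; ext y
    rw [← mul_sub, abs_mul, abs_of_pos (inv_pos.2 h0), ENNReal.ofReal_mul (by positivity), mul_assoc]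
  rw [hsc] at hle
  calc _ ≤ ENNReal.ofReal I⁻¹ * gagliardo N s 1 Set.univ v * ENNReal.ofReal I := by gcongr
    _ = gagliardo N s 1 Set.univ v * (ENNReal.ofReal I⁻¹ * ENNReal.ofReal I) := by ring
    _ = _ := by
      rw [← ENNReal.ofReal_mul (by positivity), inv_mul_cancel₀ h0.ne', ENNReal.ofReal_one, mul_one]

end

lemma core_step (N : ℕ) (hN : 0 < N) (s : ℝ) (hs : 0 < s) (hs1 : s < 1)
    (Ω : Set (EuclideanSpace ℝ (Fin N))) (ρ : EuclideanSpace ℝ (Fin N) → ℝ)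
    (hρ : LipschitzWith 1 ρ) (hE : Bornology.IsBounded {x | 0 < ρ x}) (hEΩ : {x | 0 < ρ x} ⊆ Ω)
    (hd : ∀ x, 0 < ρ x → ρ x ≤ infDist x (frontier Ω)) (t δ : ℝ) (ht : 0 < t) (hδ : 0 < δ)
    (hδ1 : δ < 1 / 4) :
    hardyConst N s 1 Ω * ∫⁻ x in {x | t ≤ ρ x}, ENNReal.ofReal (infDist x (frontier Ω) ^ (-s)) ≤
      ENNReal.ofReal (1 / ((1 - 3 * δ) * t)) * volume {x | 0 < ρ x ∧ ρ x ≤ t} *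
        (ENNReal.ofReal (2 / (1 - s)) * JJ N hN s) +
      (2 * volume {x | 0 < ρ x}) * (ENNReal.ofReal (4 * N ^ 2) * JJ N hN s) := by
  obtain ⟨v, hv, hv0, hv1, hvz, hvo, hvd⟩ := mollify N ρ hρ t δ ht hδ hδ1
  have hδt : 0 < δ * t := by positivity
  have hcl : IsClosed {x | δ * t ≤ ρ x} := isClosed_le continuous_const hρ.continuous
  have hsub : {x | δ * t ≤ ρ x} ⊆ {x | 0 < ρ x} := fun x hx => lt_of_lt_of_le hδt hx
  have hts : tsupport v ⊆ {x | δ * t ≤ ρ x} := by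
    refine closure_minimal ?_ hcl
    intro x hx
    by_contra h
    exact hx (hvz x (not_le.1 h).le)
  have hc : HasCompactSupport v :=
    HasCompactSupport.of_support_subset_isCompact
      (isCompact_of_isClosed_isBounded hcl (hE.subset hsub)) (subset_closure.trans hts)
  have hEm : MeasurableSet {x | 0 < ρ x} := (isOpen_lt continuous_const hρ.continuous).measurableSet
  have hEf : volume {x | 0 < ρ x} ≠ ⊤ := hE.measure_lt_top.ne
  have hvE : ∀ x, ¬ (0 < ρ x) → v x = 0 := fun x hx => hvz x (by linarith)
  have hint : Integrable (fun x => |v x| / Metric.infDist x (frontier Ω) ^ s)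
      (volume.restrict Ω) := by
    refine Integrable.restrict ?_
    refine Integrable.mono' (g := indicator {x | 0 < ρ x} (fun _ => (δ * t) ^ (-s))) ?_ ?_ ?_
    · exact (integrable_indicator_iff hEm).2 (integrableOn_const hEf)
    · refine Measurable.aestronglyMeasurable ?_
      exact (hv.continuous.abs.measurable).div
        ((continuous_infDist_pt _).measurable.pow_const _)
    · refine Eventually.of_forall fun x => ?_
      by_cases hx : δ * t ≤ ρ x
      · have h0 : 0 < ρ x := by linarith
        rw [indicator_of_mem (show x ∈ {x | 0 < ρ x} from h0)]
        have hdx := hd x h0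
        have : 0 < infDist x (frontier Ω) := by linarith
        rw [Real.norm_eq_abs, abs_div, abs_abs, abs_of_pos (Real.rpow_pos_of_pos this _),
          Real.rpow_neg hδt.le, div_eq_mul_inv, abs_of_nonneg (hv0 x)]
        have h2 : (infDist x (frontier Ω) ^ s)⁻¹ ≤ ((δ * t) ^ s)⁻¹ := by
          apply inv_anti₀ (by positivity)
          exact Real.rpow_le_rpow hδt.le (by linarith) hs.le
        have h3 : 0 ≤ (infDist x (frontier Ω) ^ s)⁻¹ := by positivity
        calc _ ≤ 1 * (infDist x (frontier Ω) ^ s)⁻¹ := mul_le_mul_of_nonneg_right (hv1 x) h3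
          _ ≤ _ := by rw [one_mul]; exact h2
      · rw [hvz x (not_le.1 hx).le]
        simp only [abs_zero, zero_div, norm_zero]
        exact indicator_nonneg (fun _ _ => by positivity) _
  have h1 := hardy_le N s Ω v hv hc (hts.trans (hsub.trans hEΩ)) hint
  have h2 := gag_le N hN s hs hs1 v hv
  have h3 : ∫⁻ x in {x | t ≤ ρ x}, ENNReal.ofReal (infDist x (frontier Ω) ^ (-s)) ≤
      ∫⁻ x in Ω, ENNReal.ofReal (|v x| / Metric.infDist x (frontier Ω) ^ s) := by
    have hm : MeasurableSet {x | t ≤ ρ x} := (isClosed_le continuous_const hρ.continuous).measurableSet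
    calc _ = ∫⁻ x in {x | t ≤ ρ x}, ENNReal.ofReal (|v x| / Metric.infDist x (frontier Ω) ^ s) := by
          refine setLIntegral_congr_fun hm fun x hx => ?_
          rw [hvo x hx, abs_one, Real.rpow_neg infDist_nonneg, one_div]
      _ ≤ _ := lintegral_mono_set fun x hx => hEΩ (lt_of_lt_of_le ht hx)
  have h4 : ∫⁻ x, ENNReal.ofReal ‖fderiv ℝ v x‖ ≤
      ENNReal.ofReal (1 / ((1 - 3 * δ) * t)) * volume {x | 0 < ρ x ∧ ρ x ≤ t} := by
    have hm : MeasurableSet {x | 0 < ρ x ∧ ρ x ≤ t} :=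
      hEm.inter (isClosed_le hρ.continuous continuous_const).measurableSet
    rw [← lintegral_indicator_const hm]
    refine lintegral_mono fun x => ?_
    by_cases hx : 0 < ρ x ∧ ρ x ≤ t
    · rw [indicator_of_mem (show x ∈ {x | 0 < ρ x ∧ ρ x ≤ t} from hx)]
      exact ENNReal.ofReal_le_ofReal (hvd x)
    · have : fderiv ℝ v x = 0 := by
        by_cases h0 : 0 < ρ x
        · have ht' : t < ρ x := by
            by_contra h; exact hx ⟨h0, not_lt.1 h⟩
          have : v =ᶠ[nhds x] fun _ => 1 := by
            filter_upwards [(isOpen_lt continuous_const hρ.continuous).mem_nhds ht'] with y hy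
            exact hvo y (le_of_lt hy)
          rw [this.fderiv_eq]; simp
        · have : v =ᶠ[nhds x] fun _ => 0 := by
            have ht' : ρ x < δ * t := by linarith
            filter_upwards [(isOpen_lt hρ.continuous continuous_const).mem_nhds ht'] with y hy
            exact hvz y (le_of_lt hy)
          rw [this.fderiv_eq]; simp
      rw [this]; simp
  have h5 : ∫⁻ x, ENNReal.ofReal |v x| ≤ volume {x | 0 < ρ x} := by
    rw [← lintegral_indicator_one hEm]
    refine lintegral_mono fun x => ?_
    by_cases hx : 0 < ρ x
    · rw [indicator_of_mem (show x ∈ {x | 0 < ρ x} from hx), abs_of_nonneg (hv0 x)]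
      simpa using hv1 x
    · rw [hvE x hx]; simp
  calc _ ≤ hardyConst N s 1 Ω *
        ∫⁻ x in Ω, ENNReal.ofReal (|v x| / Metric.infDist x (frontier Ω) ^ s) := by gcongr
    _ ≤ _ := h1
    _ ≤ _ := h2
    _ ≤ _ := add_le_add (mul_le_mul_left h4 _) (mul_le_mul_left (mul_le_mul_right h5 _) _)

lemma limit_step (N : ℕ) (hN : 0 < N) (s : ℝ) (hs : 0 < s) (hs1 : s < 1)
    (Ω : Set (EuclideanSpace ℝ (Fin N))) (ρ : EuclideanSpace ℝ (Fin N) → ℝ)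
    (hρ : LipschitzWith 1 ρ) (hE : Bornology.IsBounded {x | 0 < ρ x}) (hEΩ : {x | 0 < ρ x} ⊆ Ω)
    (hd : ∀ x, 0 < ρ x → ρ x ≤ infDist x (frontier Ω)) (δ : ℝ) (hδ : 0 < δ)
    (hδ1 : δ < 1 / 4) (P2 : ℝ)
    (hP2 : ∃ᶠ t in nhdsWithin (0 : ℝ) (Ioi 0),
      volume {x | 0 < ρ x ∧ ρ x ≤ t} ≤ ENNReal.ofReal (P2 * t)) :
    hardyConst N s 1 Ω * ∫⁻ x in {x | 0 < ρ x}, ENNReal.ofReal (infDist x (frontier Ω) ^ (-s)) ≤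
      ENNReal.ofReal (P2 / (1 - 3 * δ)) *
        (ENNReal.ofReal (2 / (1 - s)) * JJ N hN s) +
      (2 * volume {x | 0 < ρ x}) * (ENNReal.ofReal (4 * N ^ 2) * JJ N hN s) := by
  have hmono : Monotone fun n : ℕ => {x | 1 / ((n : ℝ) + 1) ≤ ρ x} := by
    intro n m hnm x hx
    have : 1 / ((m : ℝ) + 1) ≤ 1 / ((n : ℝ) + 1) := by gcongr
    exact this.trans hx
  have hU : {x | 0 < ρ x} = ⋃ n : ℕ, {x | 1 / ((n : ℝ) + 1) ≤ ρ x} := by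
    ext x
    simp only [mem_ofPred_eq, mem_iUnion]
    constructor
    · intro h
      obtain ⟨n, hn⟩ := exists_nat_one_div_lt h
      exact ⟨n, hn.le⟩
    · rintro ⟨n, hn⟩
      exact lt_of_lt_of_le (by positivity) hn
  rw [hU, setLIntegral_iUnion_of_directed _ hmono.directed_le, ENNReal.mul_iSup, ← hU]
  refine iSup_le fun n => ?_
  have hpos : (0 : ℝ) < 1 / ((n : ℝ) + 1) := by positivity
  obtain ⟨t, htP, ht0, htn⟩ := (hP2.and_eventually (Ioo_mem_nhdsGT hpos)).exists
  have h := core_step N hN s hs hs1 Ω ρ hρ hE hEΩ hd t δ ht0 hδ hδ1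
  have hb : 0 < 1 - 3 * δ := by linarith
  calc _ ≤ hardyConst N s 1 Ω *
        ∫⁻ x in {x | t ≤ ρ x}, ENNReal.ofReal (infDist x (frontier Ω) ^ (-s)) := by
        refine mul_le_mul_right (lintegral_mono_set fun x hx => ?_) _
        exact htn.le.trans hx
    _ ≤ _ := h
    _ ≤ _ := by
      refine add_le_add (mul_le_mul_left ?_ _) le_rfl
      calc _ ≤ ENNReal.ofReal (1 / ((1 - 3 * δ) * t)) * ENNReal.ofReal (P2 * t) :=
            mul_le_mul_right htP _
        _ = _ := by
          rw [← ENNReal.ofReal_mul (by positivity)]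
          congr 1
          field_simp

lemma layer (N : ℕ) (s : ℝ) (hs : 0 < s) (hs1 : s < 1)
    (E : Set (EuclideanSpace ℝ (Fin N))) (hE : MeasurableSet E)
    (d : EuclideanSpace ℝ (Fin N) → ℝ) (hdm : Measurable d) (hd : ∀ x ∈ E, 0 < d x)
    (P1 η : ℝ) (hη : 0 < η) (hP : 0 ≤ P1)
    (hP1 : ∀ t ∈ Ioo 0 η, ENNReal.ofReal (P1 * t) ≤ volume (E ∩ {x | d x ≤ t})) :
    ENNReal.ofReal (P1 * s * η ^ (1 - s) / (1 - s)) ≤ ∫⁻ x in E, ENNReal.ofReal (d x ^ (-s)) := by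
  have key : ∀ x ∈ E, ∫⁻ t in Ioo 0 η, (if d x ≤ t then ENNReal.ofReal (s * t ^ (-s - 1)) else 0) ≤
      ENNReal.ofReal (d x ^ (-s)) := by
    intro x hx
    have h0 := hd x hx
    have hi : IntegrableOn (fun t : ℝ => t ^ (-s - 1)) (Ioi (d x)) :=
      integrableOn_Ioi_rpow_of_lt (by linarith) h0
    have h1 : ∫ t in Ioi (d x), s * t ^ (-s - 1) = d x ^ (-s) := by
      rw [integral_const_mul, integral_Ioi_rpow_of_lt (by linarith) h0]
      have : (-s - 1 + 1) = -s := by ring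
      rw [this]; field_simp
    rw [← h1, ofReal_integral_eq_lintegral_ofReal (hi.const_mul s)
      ((ae_restrict_iff' measurableSet_Ioi).2 (Eventually.of_forall fun t ht =>
        mul_nonneg hs.le (Real.rpow_nonneg (h0.le.trans (le_of_lt ht)) _))),
      ← setLIntegral_congr Ioi_ae_eq_Ici.symm, ← lintegral_indicator measurableSet_Ici]
    refine (setLIntegral_le_lintegral _ _).trans (lintegral_mono fun t => ?_)
    simp only [indicator, mem_Ici]
    exact le_rfl
  calc _ = ∫⁻ t in Ioo 0 η, ENNReal.ofReal (s * t ^ (-s - 1)) * ENNReal.ofReal (P1 * t) := by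
        have h1 : P1 * s * η ^ (1 - s) / (1 - s) = (P1 * s) * (η ^ (-s + 1) / (-s + 1)) := by
          rw [show -s + 1 = 1 - s by ring]; ring
        rw [h1, ENNReal.ofReal_mul (by positivity), ← lint_rpow (-s) η (by linarith) hη,
          ← lintegral_const_mul' _ _ ENNReal.ofReal_ne_top]
        refine setLIntegral_congr_fun measurableSet_Ioo fun t ht => ?_
        have := ht.1
        rw [← ENNReal.ofReal_mul (by positivity), ← ENNReal.ofReal_mul (by positivity)]
        congr 1
        rw [Real.rpow_sub_one this.ne']; field_simp
    _ ≤ ∫⁻ t in Ioo 0 η, ENNReal.ofReal (s * t ^ (-s - 1)) * volume (E ∩ {x | d x ≤ t}) :=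
        setLIntegral_mono' measurableSet_Ioo fun t ht => mul_le_mul_right (hP1 t ht) _
    _ = ∫⁻ t in Ioo 0 η, ∫⁻ x in E, (if d x ≤ t then ENNReal.ofReal (s * t ^ (-s - 1)) else 0) := by
        refine lintegral_congr fun t => ?_
        have hm : MeasurableSet {x | d x ≤ t} := hdm measurableSet_Iic
        rw [inter_comm, ← Measure.restrict_apply hm, ← lintegral_indicator_const hm]
        refine lintegral_congr fun x => ?_
        simp only [indicator, mem_ofPred_eq]
    _ = ∫⁻ x in E, ∫⁻ t in Ioo 0 η, (if d x ≤ t then ENNReal.ofReal (s * t ^ (-s - 1)) else 0) := by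
        refine lintegral_lintegral_swap ?_
        refine Measurable.aemeasurable ?_
        refine Measurable.ite ?_ ?_ measurable_const
        · exact measurableSet_le (hdm.comp measurable_snd) measurable_fst
        · exact ((measurable_fst.pow_const _).const_mul s).ennreal_ofReal
    _ ≤ _ := setLIntegral_mono' hE key

lemma lemmaD (N : ℕ) (hN : 0 < N)
    (Ω : Set (EuclideanSpace ℝ (Fin N))) (ρ : EuclideanSpace ℝ (Fin N) → ℝ)
    (hρ : LipschitzWith 1 ρ) (hE : Bornology.IsBounded {x | 0 < ρ x}) (hEΩ : {x | 0 < ρ x} ⊆ Ω)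
    (hd : ∀ x, 0 < ρ x → ρ x ≤ infDist x (frontier Ω)) (P1 P2 η c : ℝ) (hP1 : 0 < P1)
    (hP20 : 0 < P2)
    (hη : 0 < η) (hc : 2 * P2 / P1 < c)
    (hP2 : ∃ᶠ t in nhdsWithin (0 : ℝ) (Ioi 0),
      volume {x | 0 < ρ x ∧ ρ x ≤ t} ≤ ENNReal.ofReal (P2 * t))
    (hP : ∀ t ∈ Ioo 0 η, ENNReal.ofReal (P1 * t) ≤
      volume ({x | 0 < ρ x} ∩ {x | infDist x (frontier Ω) ≤ t})) :
    ∀ᶠ s in nhdsWithin (1 : ℝ) (Iio 1), hardyConst N s 1 Ω ≤ ENNReal.ofReal c * JJ N hN s := by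
  have hEm : MeasurableSet {x | 0 < ρ x} := (isOpen_lt continuous_const hρ.continuous).measurableSet
  have hEf : volume {x | 0 < ρ x} ≠ ⊤ := hE.measure_lt_top.ne
  set V := (volume {x | 0 < ρ x}).toReal with hV
  have hV0 : 0 ≤ V := ENNReal.toReal_nonneg
  obtain ⟨δ, hδ, hδ1, hδc⟩ : ∃ δ : ℝ, 0 < δ ∧ δ < 1 / 4 ∧ 2 * (P2 / (1 - 3 * δ)) / P1 < c := by
    have hct : ContinuousAt (fun δ : ℝ => 2 * (P2 / (1 - 3 * δ)) / P1) 0 := by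
      refine ContinuousAt.div_const (continuousAt_const.mul (continuousAt_const.div ?_ ?_)) _
      · fun_prop
      · norm_num
    have h1 : ∀ᶠ δ in nhds (0 : ℝ), 2 * (P2 / (1 - 3 * δ)) / P1 < c :=
      hct.eventually_lt continuousAt_const (by simpa using hc)
    have h2 := (h1.filter_mono nhdsWithin_le_nhds : ∀ᶠ δ in nhdsWithin (0 : ℝ) (Ioi 0), _)
    obtain ⟨δ, h, h3, h4⟩ := (h2.and (Ioo_mem_nhdsGT (show (0 : ℝ) < 1 / 4 by norm_num))).exists
    exact ⟨δ, h3, h4, h⟩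
  have hct : ContinuousAt (fun s : ℝ => (2 * (P2 / (1 - 3 * δ)) + (1 - s) * (8 * N ^ 2 * V)) /
      (P1 * s * η ^ (1 - s))) 1 := by
    refine ContinuousAt.div (by fun_prop) ?_ ?_
    · refine ContinuousAt.mul (by fun_prop) ?_
      exact ContinuousAt.rpow continuousAt_const (by fun_prop) (Or.inl hη.ne')
    · simp [hP1.ne']
  have h1 : ∀ᶠ s in nhds (1 : ℝ), (2 * (P2 / (1 - 3 * δ)) + (1 - s) * (8 * N ^ 2 * V)) /
      (P1 * s * η ^ (1 - s)) < c :=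
    hct.eventually_lt continuousAt_const (by simpa using hδc)
  filter_upwards [h1.filter_mono nhdsWithin_le_nhds,
    Ioo_mem_nhdsLT (show (0 : ℝ) < 1 by norm_num)] with s hsc hs01
  obtain ⟨hs, hs1⟩ := hs01
  have hb : 0 < 1 - 3 * δ := by linarith
  have hs2 : 0 < 1 - s := by linarith
  have hL := limit_step N hN s hs hs1 Ω ρ hρ hE hEΩ hd δ hδ hδ1 P2 hP2
  have hY := layer N s hs hs1 {x | 0 < ρ x} hEm (fun x => infDist x (frontier Ω))
    (continuous_infDist_pt _).measurable (fun x hx => lt_of_lt_of_le hx (hd x hx)) P1 η hη hP1.le hP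
  set A := P1 * s * η ^ (1 - s) / (1 - s) with hA
  have hA0 : 0 < A := by positivity
  have hle : hardyConst N s 1 Ω * ENNReal.ofReal A ≤
      (ENNReal.ofReal c * JJ N hN s) * ENNReal.ofReal A := by
    calc _ ≤ _ := mul_le_mul_right hY _
      _ ≤ _ := hL
      _ = ENNReal.ofReal ((P2 / (1 - 3 * δ)) * (2 / (1 - s)) + 2 * V * (4 * N ^ 2)) *
          JJ N hN s := by
          have h2 : (2 : ℝ≥0∞) = ENNReal.ofReal 2 := by simp
          rw [← ENNReal.ofReal_toReal hEf, ← hV, h2, ← mul_assoc, ← mul_assoc, ← add_mul,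
            ← ENNReal.ofReal_mul (by positivity), ← ENNReal.ofReal_mul (by positivity),
            ← ENNReal.ofReal_mul (by positivity),
            ← ENNReal.ofReal_add (by positivity) (by positivity)]
      _ ≤ ENNReal.ofReal (c * A) * JJ N hN s := by
          refine mul_le_mul_left (ENNReal.ofReal_le_ofReal ?_) _
          have := hsc.le
          rw [div_le_iff₀ (by positivity)] at this
          rw [hA]
          calc _ = (2 * (P2 / (1 - 3 * δ)) + (1 - s) * (8 * N ^ 2 * V)) / (1 - s) := by
                field_simp; ring
            _ ≤ (c * (P1 * s * η ^ (1 - s))) / (1 - s) := by gcongr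
            _ = _ := by ring
      _ = _ := by
          rw [ENNReal.ofReal_mul' hA0.le]; ring
  have hA1 : ENNReal.ofReal A ≠ 0 := by simpa using hA0
  exact (ENNReal.mul_le_mul_iff_left hA1 ENNReal.ofReal_ne_top).1 hle

lemma vol_hom (N : ℕ) (hN : 0 < N) (Ω : Set (EuclideanSpace ℝ (Fin N))) (hop : IsOpen Ω)
    (hconv : Convex ℝ Ω) (hbd : Bornology.IsBounded Ω) (x0 : EuclideanSpace ℝ (Fin N)) (hx0 : x0 ∈ Ω)
    (l : ℝ) (hl0 : 0 < l) (hl1 : l < 1) :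
    volume (Ω \ (AffineMap.homothety x0 (1 - l) '' Ω)) =
      ENNReal.ofReal ((1 - (1 - l) ^ N) * (volume Ω).toReal) := by
  have hf : volume Ω ≠ ⊤ := hbd.measure_lt_top.ne
  have hsub : AffineMap.homothety x0 (1 - l) '' Ω ⊆ Ω := by
    rintro _ ⟨y, hy, rfl⟩
    rw [AffineMap.homothety_eq_lineMap]
    exact hconv.lineMap_mem hx0 hy ⟨by linarith, by linarith⟩
  have hv : volume (AffineMap.homothety x0 (1 - l) '' Ω) = ENNReal.ofReal ((1 - l) ^ N) * volume Ω := by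
    rw [Measure.addHaar_image_homothety, finrank_euclideanSpace_fin,
      abs_of_nonneg (by have : 0 < 1 - l := by linarith
                        positivity)]
  have hm : MeasurableSet (AffineMap.homothety x0 (1 - l) '' Ω) :=
    (AffineMap.homothety_isOpenMap x0 (1 - l) (by linarith) Ω hop).measurableSet
  have hp : (0 : ℝ) ≤ (1 - l) ^ N := by
    have : 0 < 1 - l := by linarith
    positivity
  have hp1 : (1 - l) ^ N ≤ 1 := pow_le_one₀ (by linarith) (by linarith)
  rw [measure_sdiff hsub hm.nullMeasurableSet (measure_ne_top_of_subset hsub hf), hv]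
  conv_lhs => rw [← ENNReal.ofReal_toReal hf]
  rw [← ENNReal.ofReal_mul hp, ← ENNReal.ofReal_sub _ (mul_nonneg hp ENNReal.toReal_nonneg)]
  congr 1; ring

lemma vol_up (N : ℕ) (hN : 0 < N) (Ω : Set (EuclideanSpace ℝ (Fin N))) (hop : IsOpen Ω)
    (hconv : Convex ℝ Ω) (hbd : Bornology.IsBounded Ω) (x0 : EuclideanSpace ℝ (Fin N)) (r : ℝ)
    (hr : 0 < r) (hb : ball x0 r ⊆ Ω) (hne : Ωᶜ.Nonempty) (t : ℝ) (ht : 0 < t) (htr : 2 * t < r) :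
    volume {x | 0 < infDist x Ωᶜ ∧ infDist x Ωᶜ ≤ t} ≤
      ENNReal.ofReal (N * (2 / r) * (volume Ω).toReal * t) := by
  set l := 2 * t / r with hl
  have hl0 : 0 < l := by positivity
  have hl1 : l < 1 := by rw [hl, div_lt_one hr]; exact htr
  have hlr : l * r = 2 * t := by rw [hl]; field_simp
  have hsub : {x | 0 < infDist x Ωᶜ ∧ infDist x Ωᶜ ≤ t} ⊆
      Ω \ (AffineMap.homothety x0 (1 - l) '' Ω) := by
    rintro x ⟨h1, h2⟩
    refine ⟨?_, ?_⟩
    · by_contra h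
      exact h1.ne' (infDist_zero_of_mem h)
    · rintro ⟨y, hy, hyx⟩
      obtain ⟨z, hz, hzd⟩ := (infDist_lt_iff hne).1 (lt_of_le_of_lt h2 (by linarith : t < 2 * t))
      apply hz
      have hw : x0 + l⁻¹ • (z - x) ∈ Ω := by
        apply hb
        rw [mem_ball, dist_eq_norm, add_sub_cancel_left, norm_smul, Real.norm_of_nonneg (by positivity),
          ← dist_eq_norm, dist_comm, inv_mul_lt_iff₀ hl0, hlr]
        exact hzd
      have := hconv hy hw (by linarith : 0 ≤ 1 - l) hl0.le (by ring)
      have hz2 : z = (1 - l) • y + l • (x0 + l⁻¹ • (z - x)) := by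
        rw [smul_add, smul_inv_smul₀ hl0.ne', ← hyx, AffineMap.homothety_apply]
        simp only [vsub_eq_sub, vadd_eq_add]
        module
      rw [hz2]; exact this
  refine (measure_mono hsub).trans ?_
  rw [vol_hom N hN Ω hop hconv hbd x0 (hb (mem_ball_self hr)) l hl0 hl1]
  refine ENNReal.ofReal_le_ofReal ?_
  have h1 := one_add_mul_le_pow (show (-2 : ℝ) ≤ -l by linarith) N
  rw [← sub_eq_add_neg] at h1
  calc _ ≤ (N * l) * (volume Ω).toReal := by
        gcongr
        linarith
    _ = _ := by rw [hl]; ring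

lemma vol_dn (N : ℕ) (hN : 0 < N) (Ω : Set (EuclideanSpace ℝ (Fin N))) (hop : IsOpen Ω)
    (hconv : Convex ℝ Ω) (hbd : Bornology.IsBounded Ω) (x0 : EuclideanSpace ℝ (Fin N)) (R : ℝ)
    (hR : 0 < R) (hx0 : x0 ∈ Ω) (hb : Ω ⊆ ball x0 R) (hne : Ωᶜ.Nonempty) (t : ℝ) (ht : 0 < t)
    (htr : t < R) :
    ENNReal.ofReal (1 / (2 * R) * (volume Ω).toReal * t) ≤
    volume {x | 0 < infDist x Ωᶜ ∧ infDist x Ωᶜ ≤ t} := by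
  set l := t / (R + t) with hl
  have hl0 : 0 < l := by positivity
  have hl1 : l < 1 := by rw [hl, div_lt_one (by positivity)]; linarith
  have hl2 : 0 < 1 - l := by linarith
  have hsub : Ω \ (AffineMap.homothety x0 (1 - l) '' Ω) ⊆
     {x | 0 < infDist x Ωᶜ ∧ infDist x Ωᶜ ≤ t} := by
    rintro x ⟨h1, h2⟩
    refine ⟨(hop.isClosed_compl.notMem_iff_infDist_pos hne).1 (by simpa using h1), ?_⟩
    have hy : x0 + (1 - l)⁻¹ • (x - x0) ∈ Ωᶜ := by
      intro hy
      refine h2 ⟨_, hy, ?_⟩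
      rw [AffineMap.homothety_apply]
      simp only [vsub_eq_sub, vadd_eq_add, add_sub_cancel_left]
      rw [smul_inv_smul₀ hl2.ne']; simp
    refine (infDist_le_dist_of_mem hy).trans ?_
    have h3 : x0 + (1 - l)⁻¹ • (x - x0) - x = ((1 - l)⁻¹ - 1) • (x - x0) := by module
    have h4 : (1 - l)⁻¹ - 1 = t / R := by
      have : 1 - l = R / (R + t) := by rw [hl]; field_simp; ring
      rw [this]; field_simp; ring
    rw [dist_comm, dist_eq_norm, h3, h4, norm_smul, Real.norm_of_nonneg (by positivity),
      ← dist_eq_norm]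
    calc _ ≤ t / R * R := by
          have := (mem_ball.1 (hb h1)).le
          gcongr
      _ = t := by field_simp
  refine le_trans ?_ (measure_mono hsub)
  rw [vol_hom N hN Ω hop hconv hbd x0 hx0 l hl0 hl1]
  refine ENNReal.ofReal_le_ofReal ?_
  have h1 : (1 - l) ^ N ≤ 1 - l := pow_le_of_le_one hl2.le (by linarith) hN.ne'
  calc _ = (t / (2 * R)) * (volume Ω).toReal := by ring
    _ ≤ _ := by
      gcongr
      have : t / (2 * R) ≤ l := by rw [hl]; gcongr; linarith
      linarith

lemma upper_convex (N : ℕ) (hN : 0 < N) (Ω : Set (EuclideanSpace ℝ (Fin N))) (hne : Ω.Nonempty)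
    (hop : IsOpen Ω) (hconv : Convex ℝ Ω) (hbd : Bornology.IsBounded Ω) (hnu : Ω ≠ univ) (c : ℝ)
    (hc : 2 < c) :
    ∀ᶠ s in nhdsWithin (1 : ℝ) (Iio 1), hardyConst N s 1 Ω ≤ ENNReal.ofReal c * JJ N hN s := by
  obtain ⟨x0, hx0⟩ := hne
  have hcn : Ωᶜ.Nonempty := nonempty_compl.2 hnu
  obtain ⟨r, hr, hbr⟩ := Metric.isOpen_iff.1 hop x0 hx0
  obtain ⟨R, hR, hbR⟩ := hbd.subset_ball_lt 0 x0
  have hV : 0 < (volume Ω).toReal :=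
    ENNReal.toReal_pos (hop.measure_pos _ ⟨x0, hx0⟩).ne' hbd.measure_lt_top.ne
  set V := (volume Ω).toReal with hVd
  set m : ℝ → ℝ≥0∞ := fun t => volume {x : EuclideanSpace ℝ (Fin N) | 0 < infDist x Ωᶜ ∧ infDist x Ωᶜ ≤ t} with hm
  set P := liminf (fun t => m t / ENNReal.ofReal t) (nhdsWithin (0 : ℝ) (Ioi 0)) with hP
  have hup : P ≤ ENNReal.ofReal (N * (2 / r) * V) := by
    have h1 : ∀ᶠ t in nhdsWithin (0 : ℝ) (Ioi 0),
        m t / ENNReal.ofReal t ≤ ENNReal.ofReal (N * (2 / r) * V) := by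
      filter_upwards [Ioo_mem_nhdsGT (show (0 : ℝ) < r / 2 by positivity)] with t ht
      have := vol_up N hN Ω hop hconv hbd x0 r hr hbr hcn t ht.1 (by linarith [ht.2])
      refine ENNReal.div_le_of_le_mul ?_
      rw [← ENNReal.ofReal_mul (by positivity)]
      exact this
    exact liminf_le_of_frequently_le' h1.frequently
  have hdn : ENNReal.ofReal (1 / (2 * R) * V) ≤ P := by
    refine le_liminf_of_le (by isBoundedDefault) ?_
    filter_upwards [Ioo_mem_nhdsGT hR] with t ht
    have := vol_dn N hN Ω hop hconv hbd x0 R hR hx0 hbR hcn t ht.1 ht.2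
    rw [ENNReal.le_div_iff_mul_le (Or.inl (by simpa using ht.1)) (Or.inl ENNReal.ofReal_ne_top),
      ← ENNReal.ofReal_mul (by positivity)]
    exact this
  have hPf : P ≠ ⊤ := ne_top_of_le_ne_top ENNReal.ofReal_ne_top hup
  have hP0 : P ≠ 0 := fun h => by
    rw [h, nonpos_iff_eq_zero, ENNReal.ofReal_eq_zero] at hdn
    have : 0 < 1 / (2 * R) * V := by positivity
    linarith [this]
  have hp : 0 < P.toReal := ENNReal.toReal_pos hP0 hPf
  set p := P.toReal with hpd
  have hPp : P = ENNReal.ofReal p := (ENNReal.ofReal_toReal hPf).symm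
  obtain ⟨e, he, hec⟩ : ∃ e : ℝ, 1 < e ∧ 2 * (e * e) < c := by
    refine ⟨Real.sqrt ((c + 2) / 4), ?_, ?_⟩
    · rw [Real.lt_sqrt (by norm_num)]; linarith
    · rw [Real.mul_self_sqrt (by linarith)]; linarith
  have he0 : 0 < e := by linarith
  have h2 : ∃ᶠ t in nhdsWithin (0 : ℝ) (Ioi 0), m t / ENNReal.ofReal t < ENNReal.ofReal (e * p) := by
    refine frequently_lt_of_liminf_lt (by isBoundedDefault) ?_
    rw [← hP, hPp, ENNReal.ofReal_lt_ofReal_iff (by positivity)]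
    nlinarith
  have h1 : ∀ᶠ t in nhdsWithin (0 : ℝ) (Ioi 0), ENNReal.ofReal (p / e) < m t / ENNReal.ofReal t := by
    refine eventually_lt_of_lt_liminf ?_ (by isBoundedDefault)
    rw [← hP, hPp, ENNReal.ofReal_lt_ofReal_iff hp, div_lt_iff₀ he0]
    nlinarith
  obtain ⟨η, hη, hη1⟩ := mem_nhdsGT_iff_exists_Ioo_subset.1 h1
  have hfr : ∀ x ∈ Ω, infDist x (frontier Ω) = infDist x Ωᶜ := fun x hx =>
    infDist_frontier_eq N Ω hop hnu x hx
  have hE : {x : EuclideanSpace ℝ (Fin N) | 0 < infDist x Ωᶜ} ⊆ Ω := fun x hx => by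
    by_contra h
    exact (ne_of_gt hx) (infDist_zero_of_mem h)
  refine lemmaD N hN Ω (fun x => infDist x Ωᶜ) (lipschitz_infDist_pt _) (hbd.subset hE) hE
    (fun x hx => (hfr x (hE hx)).ge) (p / e) (e * p) η c (by positivity) (by positivity) hη ?_ ?_ ?_
  · calc _ = 2 * (e * e) := by field_simp
      _ < c := hec
  · refine (h2.and_eventually self_mem_nhdsWithin).mono ?_
    rintro t ⟨ht, ht0⟩
    have ht0' : 0 < t := ht0
    have := (ENNReal.div_le_iff_le_mul (Or.inl (by simpa using ht0')) (Or.inl ENNReal.ofReal_ne_top)).1 ht.le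
    rwa [← ENNReal.ofReal_mul (by positivity)] at this
  · intro t ht
    have h4 : ENNReal.ofReal (p / e) < m t / ENNReal.ofReal t := hη1 ht
    have h3 := h4.le
    rw [ENNReal.le_div_iff_mul_le (Or.inl (by simpa using ht.1)) (Or.inl ENNReal.ofReal_ne_top),
      ← ENNReal.ofReal_mul (by positivity)] at h3
    refine h3.trans (measure_mono ?_)
    rintro x ⟨hx1, hx2⟩
    refine ⟨hx1, ?_⟩
    rw [mem_ofPred_eq, hfr x (hE hx1)]
    exact hx2

lemma slab (N : ℕ) (z i : Fin N) (r : ℝ) (T : Set ℝ) :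
    volume {x : EuclideanSpace ℝ (Fin N) | x i ∈ T ∧
      ∀ j, j ≠ i → x j ∈ Ioo 0 (if j = z then r else 1)} =
      volume T * (if i = z then 1 else ENNReal.ofReal r) := by
  have h1 : {x : EuclideanSpace ℝ (Fin N) | x i ∈ T ∧
      ∀ j, j ≠ i → x j ∈ Ioo 0 (if j = z then r else 1)} =
      (WithLp.ofLp : EuclideanSpace ℝ (Fin N) → (Fin N → ℝ)) ⁻¹'
        (Set.pi univ (Function.update (fun j => Ioo 0 (if j = z then r else 1)) i T)) := by
    ext x
    simp only [mem_ofPred_eq, mem_preimage, Set.mem_pi, mem_univ, true_implies]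
    constructor
    · rintro ⟨h, h'⟩ j
      by_cases hj : j = i
      · subst hj; simpa using h
      · rw [Function.update_of_ne hj]; exact h' j hj
    · intro h
      refine ⟨by simpa using h i, fun j hj => ?_⟩
      have := h j
      rwa [Function.update_of_ne hj] at this
  have hmp := EuclideanSpace.volume_preserving_symm_measurableEquiv_toLp (Fin N)
  have h2 := hmp.measure_preimage_equiv
    (Set.pi univ (Function.update (fun j => Ioo 0 (if j = z then r else 1)) i T))
  rw [h1]
  refine h2.trans ?_
  rw [volume_pi_pi]
  have h3 : ∀ j, volume (Function.update (fun j => Ioo (0 : ℝ) (if j = z then r else 1)) i T j) =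
      Function.update (fun j => if j = z then ENNReal.ofReal r else 1) i (volume T) j := by
    intro j
    by_cases hj : j = i
    · subst hj; simp
    · rw [Function.update_of_ne hj, Function.update_of_ne hj]
      split_ifs <;> simp
  rw [Finset.prod_congr rfl fun j _ => h3 j, Finset.prod_update_of_mem (Finset.mem_univ i),
    Finset.prod_ite_eq']
  congr 1
  by_cases h : i = z
  · simp [h]
  · simp [h, Ne.symm h]

lemma upper_half (N : ℕ) (hN : 0 < N) (c : ℝ) (hc : 4 < c) :
    ∀ᶠ s in nhdsWithin (1 : ℝ) (Iio 1),
      hardyConst N s 1 (halfSpace N hN) ≤ ENNReal.ofReal c * JJ N hN s := by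
  set z : Fin N := ⟨0, hN⟩ with hz
  have hN' : (0 : ℝ) < N := by exact_mod_cast hN
  set r : ℝ := (c - 4) / (8 * N) with hr
  have hr0 : 0 < r := div_pos (by linarith) (by positivity)
  set Q : Fin N → ℝ := fun j => if j = z then r else 1 with hQ
  have hne : (Finset.univ : Finset (Fin N)).Nonempty := ⟨z, Finset.mem_univ _⟩
  set ρ : EuclideanSpace ℝ (Fin N) → ℝ := fun x =>
    Finset.univ.inf' hne (fun i => min (x i) (Q i - x i)) with hρ
  have hle : ∀ x i, ρ x ≤ min (x i) (Q i - x i) := fun x i =>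
    Finset.inf'_le (fun i => min (x i) (Q i - x i)) (Finset.mem_univ i)
  have hex : ∀ x, ∃ i, ρ x = min (x i) (Q i - x i) := fun x => by
    obtain ⟨i, -, hi⟩ := Finset.exists_mem_eq_inf' hne (fun i => min (x i) (Q i - x i))
    exact ⟨i, hi⟩
  have hpos : ∀ x, 0 < ρ x ↔ ∀ i, x i ∈ Ioo 0 (Q i) := by
    intro x
    simp only [hρ, Finset.lt_inf'_iff, Finset.mem_univ, true_implies, lt_min_iff, sub_pos, mem_Ioo]
  have hlip : LipschitzWith 1 ρ := by
    refine LipschitzWith.of_le_add fun x y => ?_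
    obtain ⟨i, hi⟩ := hex y
    have h1 := hle x i
    have h2 : |x i - y i| ≤ dist x y := by
      rw [dist_eq_norm, ← Real.norm_eq_abs]
      exact PiLp.norm_apply_le (x - y) i
    have h3 := abs_le.1 h2
    rw [hi, ← min_add_add_right]
    refine h1.trans (min_le_min ?_ ?_) <;> linarith [h3.1, h3.2]
  clear_value ρ
  have hbdd : Bornology.IsBounded {x | 0 < ρ x} := by
    have hK : IsCompact ((WithLp.toLp 2 : (Fin N → ℝ) → EuclideanSpace ℝ (Fin N)) '' (Icc 0 Q)) :=
      isCompact_Icc.image (PiLp.continuous_toLp 2 _)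
    refine hK.isBounded.subset fun x hx => ?_
    have := (hpos x).1 hx
    exact ⟨WithLp.ofLp x, ⟨fun i => (this i).1.le, fun i => (this i).2.le⟩, rfl⟩
  have hEΩ : {x | 0 < ρ x} ⊆ halfSpace N hN := fun x hx => ((hpos x).1 hx z).1
  have hdE : ∀ x, 0 < ρ x → infDist x (frontier (halfSpace N hN)) = x z := fun x hx =>
    halfSpace_infDist N hN x (hEΩ hx)
  refine lemmaD N hN _ ρ hlip hbdd hEΩ ?_ 1 (2 + 2 * N * r) r c one_pos (by positivity) hr0 ?_ ?_ ?_
  · intro x hx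
    rw [hdE x hx]
    exact (hle x z).trans (min_le_left _ _)
  · have : r * (8 * N) = c - 4 := by rw [hr]; field_simp
    linarith
  · refine Eventually.frequently ?_
    filter_upwards [self_mem_nhdsWithin] with t ht
    have ht0 : 0 < t := ht
    have hsub : {x | 0 < ρ x ∧ ρ x ≤ t} ⊆ ⋃ i : Fin N,
        ({x : EuclideanSpace ℝ (Fin N) | x i ∈ Ioc 0 t ∧
          ∀ j, j ≠ i → x j ∈ Ioo 0 (if j = z then r else 1)} ∪
        {x : EuclideanSpace ℝ (Fin N) | x i ∈ Ico (Q i - t) (Q i) ∧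
          ∀ j, j ≠ i → x j ∈ Ioo 0 (if j = z then r else 1)}) := by
      rintro x ⟨h1, h2⟩
      obtain ⟨i, hi⟩ := hex x
      have hp := (hpos x).1 h1
      rw [hi] at h2
      refine mem_iUnion.2 ⟨i, ?_⟩
      rcases min_le_iff.1 h2 with h | h
      · exact Or.inl ⟨⟨(hp i).1, h⟩, fun j _ => hp j⟩
      · exact Or.inr ⟨⟨by linarith, (hp i).2⟩, fun j _ => hp j⟩
    calc _ ≤ _ := measure_mono hsub
      _ ≤ ∑ i : Fin N, (ENNReal.ofReal t * (if i = z then 1 else ENNReal.ofReal r) +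
            ENNReal.ofReal t * (if i = z then 1 else ENNReal.ofReal r)) := by
          refine (measure_iUnion_fintype_le _ _).trans (Finset.sum_le_sum fun i _ => ?_)
          refine (measure_union_le _ _).trans ?_
          rw [slab, slab, Real.volume_Ioc, Real.volume_Ico, sub_zero, sub_sub_cancel]
      _ ≤ ∑ i : Fin N, (ENNReal.ofReal (2 * t) * ((if i = z then 1 else 0) + ENNReal.ofReal r)) := by
          refine Finset.sum_le_sum fun i _ => ?_
          rw [← two_mul, ← mul_assoc, ENNReal.ofReal_mul (by norm_num : (0 : ℝ) ≤ 2),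
            show ENNReal.ofReal 2 = 2 by simp]
          refine mul_le_mul_right ?_ _
          split_ifs
          · exact le_self_add
          · exact le_add_self
      _ = _ := by
          rw [← Finset.mul_sum, Finset.sum_add_distrib, Finset.sum_ite_eq', Finset.sum_const,
            Finset.card_univ, Fintype.card_fin, nsmul_eq_mul, if_pos (Finset.mem_univ _),
            ← ENNReal.ofReal_natCast, ← ENNReal.ofReal_one, ← ENNReal.ofReal_mul (by positivity),
            ← ENNReal.ofReal_add (by positivity) (by positivity),
            ← ENNReal.ofReal_mul (by positivity)]
          congr 1; ring
  · intro t ht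
    have h := slab N z z r (Ioc 0 t)
    rw [if_pos rfl, mul_one, Real.volume_Ioc, sub_zero] at h
    rw [one_mul, ← h]
    refine measure_mono ?_
    rintro x ⟨h1, h2⟩
    have hp : 0 < ρ x := by
      refine (hpos x).2 fun j => ?_
      by_cases hj : j = z
      · subst hj
        refine ⟨h1.1, lt_of_le_of_lt h1.2 ?_⟩
        simpa [hQ] using ht.2
      · exact h2 j hj
    refine ⟨hp, ?_⟩
    rw [mem_ofPred_eq, hdE x hp]
    exact h1.2

/-- for `N ≥ 2` and `Ω ⊊ ℝ^N` nonempty bounded convex open,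
`𝔥_{s,1}(Ω)/𝔥_{s,1}(ℍ^N₊) → 1/2` as `s → 1⁻`. -/
theorem hardy_ratio_tendsto_half (N : ℕ) (hN : 2 ≤ N)
    (Ω : Set (EuclideanSpace ℝ (Fin N))) (hne : Ω.Nonempty) (hop : IsOpen Ω)
    (hconv : Convex ℝ Ω) (hbd : Bornology.IsBounded Ω) :
    Filter.Tendsto
      (fun s : ℝ => hardyConst N s 1 Ω / hardyConst N s 1 (halfSpace N (by omega)))
      (nhdsWithin 1 (Set.Iio 1)) (nhds (1 / 2 : ℝ≥0∞)) := by
  have hN0 : 0 < N := by omega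
  have hnu : Ω ≠ univ := by
    rintro rfl
    have : Nonempty (Fin N) := ⟨⟨0, hN0⟩⟩
    exact NormedSpace.unbounded_univ ℝ (EuclideanSpace ℝ (Fin N)) hbd
  have hhalf : (1 / 2 : ℝ≥0∞) = ENNReal.ofReal (1 / 2) := by
    rw [ENNReal.ofReal_div_of_pos (by norm_num)]; simp
  rw [hhalf]
  refine tendsto_order.2 ⟨fun a ha => ?_, fun a ha => ?_⟩
  · obtain ⟨c, hc, hac⟩ : ∃ c : ℝ, 4 < c ∧ a < ENNReal.ofReal (2 / c) := by
      have hat : a ≠ ⊤ := ha.ne_top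
      have ha' := (ENNReal.lt_ofReal_iff_toReal_lt hat).1 ha
      have hct : ContinuousAt (fun c : ℝ => 2 / c) 4 :=
        continuousAt_const.div continuousAt_id (by norm_num)
      have h1 : ∀ᶠ c in nhds (4 : ℝ), a.toReal < 2 / c :=
        continuousAt_const.eventually_lt hct (by norm_num at ha' ⊢; exact ha')
      obtain ⟨c, h2, h3⟩ := ((h1.filter_mono nhdsWithin_le_nhds :
        ∀ᶠ c in nhdsWithin (4 : ℝ) (Ioi 4), _).and self_mem_nhdsWithin).exists
      exact ⟨c, h3, (ENNReal.lt_ofReal_iff_toReal_lt hat).2 h2⟩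
    have hc0 : 0 < c := by linarith
    filter_upwards [upper_half N hN0 c hc, Ioo_mem_nhdsLT (show (0 : ℝ) < 1 by norm_num)] with s h1 hs
    refine lt_of_lt_of_le hac ?_
    have hJ0 := JJ_pos N hN0 s
    have hJf := JJ_fin N hN0 s hs.1
    have hl := hardy_convex_ge N hN0 s Ω hop hconv hnu
    have hd0 : hardyConst N s 1 (halfSpace N hN0) ≠ 0 := by
      intro h
      have := hardy_half_ge N hN0 s hs.1
      rw [h] at this
      simp [hJ0] at this
    have hdf : hardyConst N s 1 (halfSpace N hN0) ≠ ⊤ :=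
      ne_top_of_le_ne_top (ENNReal.mul_ne_top ENNReal.ofReal_ne_top hJf) h1
    rw [ENNReal.le_div_iff_mul_le (Or.inl hd0) (Or.inl hdf)]
    calc _ ≤ ENNReal.ofReal (2 / c) * (ENNReal.ofReal c * JJ N hN0 s) := mul_le_mul_right h1 _
      _ = 2 * JJ N hN0 s := by
        rw [← mul_assoc, ← ENNReal.ofReal_mul (by positivity), div_mul_cancel₀ _ hc0.ne']
        simp
      _ ≤ _ := hl
  · obtain ⟨c, hc, hac⟩ : ∃ c : ℝ, 2 < c ∧ ENNReal.ofReal (c / 4) < a := by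
      have h0 : ContinuousAt (fun c : ℝ => ENNReal.ofReal (c / 4)) 2 :=
        ENNReal.continuous_ofReal.continuousAt.comp (by fun_prop)
      have h1 : ∀ᶠ c in nhds (2 : ℝ), ENNReal.ofReal (c / 4) < a :=
        h0.eventually_lt continuousAt_const (by
          rw [show (2 / 4 : ℝ) = 1 / 2 by norm_num]; exact ha)
      obtain ⟨c, h2, h3⟩ := ((h1.filter_mono nhdsWithin_le_nhds :
        ∀ᶠ c in nhdsWithin (2 : ℝ) (Ioi 2), _).and self_mem_nhdsWithin).exists
      exact ⟨c, h3, h2⟩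
    filter_upwards [upper_convex N hN0 Ω hne hop hconv hbd hnu c hc,
      Ioo_mem_nhdsLT (show (0 : ℝ) < 1 by norm_num)] with s h1 hs
    refine lt_of_le_of_lt ?_ hac
    have hl := hardy_half_ge N hN0 s hs.1
    refine ENNReal.div_le_of_le_mul ?_
    calc _ ≤ _ := h1
      _ = ENNReal.ofReal (c / 4) * (4 * JJ N hN0 s) := by
        rw [← mul_assoc, show (4 : ℝ≥0∞) = ENNReal.ofReal 4 by simp,
          ← ENNReal.ofReal_mul (by linarith), div_mul_cancel₀ _ (by norm_num)]
      _ ≤ _ := mul_le_mul_right hl _
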